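/- arXiv:math/0306276 — 2 statements merged into one kernel-verified Lean document; each statement's English description precedes it below -/
import Mathlib

section
/- Let w : ℕ → {0,1} be an admissible word and define S(w) := {p ∈ ℝ² : for every n ≥ 0 the forward orbit of p is defined up to time n and fⁿ(p) ∈ R_{w(n)}}. Then: (i) any two points p = (p₁,p₂) and q = (q₁,q₂) of S(w) satisfy (p₁ − q₁)(p₂ − q₂) ≤ 0 — so S(w) lies on the graph of a non-increasing function and in particular has empty interior in ℝ²; and (ii) if in addition for every K ≥ 0 there exists n ≥ K with w(n) = w(n+1) (w is not eventually alternating), then S(w) is nonempty. -/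
open Filter

/-- The birational map f(x,y) = (y(x+a)/(x-1), x+a-1). -/
noncomputable def birat (a : ℝ) (p : ℝ × ℝ) : ℝ × ℝ :=
  (p.2 * (p.1 + a) / (p.1 - 1), p.1 + a - 1)

/-- The inverse map f⁻¹(x,y) = (y+1-a, x(y-a)/(y+1)). -/
noncomputable def biratInv (a : ℝ) (p : ℝ × ℝ) : ℝ × ℝ :=
  (p.2 + 1 - a, p.1 * (p.2 - a) / (p.2 + 1))

/-- The forward orbit of `p` is defined up to time `n`. -/
def orbitDefined (a : ℝ) (p : ℝ × ℝ) (n : ℕ) : Prop :=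
  ∀ k < n, ((birat a)^[k] p).1 ≠ 1

def Rplus : Set (ℝ × ℝ) := {p | p.1 ≤ 1 ∧ p.2 ≤ 0}
def Rminus : Set (ℝ × ℝ) := {p | 0 ≤ p.1 ∧ -1 ≤ p.2}
def Rzero : Set (ℝ × ℝ) := {p | 1 ≤ p.1 ∧ p.2 ≤ -1}
def Rone : Set (ℝ × ℝ) := {p | p.1 ≤ 0 ∧ 0 ≤ p.2}
def intRplus : Set (ℝ × ℝ) := {p | p.1 < 1 ∧ p.2 < 0}
def intRzero : Set (ℝ × ℝ) := {p | 1 < p.1 ∧ p.2 < -1}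
def intRone : Set (ℝ × ℝ) := {p | p.1 < 0 ∧ 0 < p.2}

/-- `Rw 0 = R₀`, `Rw 1 = R₁`. -/
def Rw (i : Fin 2) : Set (ℝ × ℝ) := if i = 0 then Rzero else Rone

/-- `intRw 0 = int R₀`, `intRw 1 = int R₁`. -/
def intRw (i : Fin 2) : Set (ℝ × ℝ) := if i = 0 then intRzero else intRone

/-- Euclidean distance on ℝ². -/
noncomputable def eucDist (p q : ℝ × ℝ) : ℝ :=
  Real.sqrt ((p.1 - q.1) ^ 2 + (p.2 - q.2) ^ 2)


/-! ### Real inequalities for the transitions, with `c = -(a + 1)` and `v = -y` -/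

theorem zero_zero_order {c xq xp vq vp Xq Xp : ℝ} (hq : 1 < xq) (hqp : xq < xp)
    (hvp : 1 ≤ vp) (hvq : 1 ≤ vq) (hm : vp * xq ≤ vq * xp)
    (hXp : Xp * (xp - 1) = vp * (c + 1 - xp)) (hXq : Xq * (xq - 1) = vq * (c + 1 - xq))
    (hXp1 : 1 ≤ Xp) :
    Xp < Xq ∧ (c + 2 - xq) * Xp ≤ (c + 2 - xp) * Xq := by
  have hp : 1 < xp := hq.trans hqp
  have hp' : 0 < c + 1 - xp := by
    by_contra! h
    nlinarith [mul_pos (by linarith : (0 : ℝ) < Xp) (by linarith : 0 < xp - 1)]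
  have key : (c + 2 - xq) * Xp ≤ (c + 2 - xp) * Xq := by
    have h1 : xp * (xq - 1) ≤ xq * (xp - 1) := by nlinarith
    have h2 : (c + 1 - xp) * (c + 2 - xq) ≤ (c + 1 - xq) * (c + 2 - xp) := by nlinarith
    have h3 : (xp * (xq - 1)) * ((c + 1 - xp) * (c + 2 - xq)) ≤
        (xq * (xp - 1)) * ((c + 1 - xq) * (c + 2 - xp)) :=
      mul_le_mul h1 h2 (mul_nonneg hp'.le (by linarith))
        (mul_nonneg (by linarith) (by linarith))
    have h4 : vp * xq * ((xq - 1) * ((c + 1 - xp) * (c + 2 - xq))) ≤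
        vq * xp * ((xq - 1) * ((c + 1 - xp) * (c + 2 - xq))) :=
      mul_le_mul_of_nonneg_right hm
        (mul_nonneg (by linarith) (mul_nonneg hp'.le (by linarith)))
    have h5 := mul_le_mul_of_nonneg_left h3 (by linarith : 0 ≤ vq)
    have hpos : 0 < xq * ((xp - 1) * (xq - 1)) :=
      mul_pos (by linarith) (mul_pos (by linarith) (by linarith))
    refine le_of_mul_le_mul_right ?_ hpos
    calc (c + 2 - xq) * Xp * (xq * ((xp - 1) * (xq - 1)))
        = (Xp * (xp - 1)) * ((c + 2 - xq) * xq * (xq - 1)) := by ring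
      _ = vp * xq * ((xq - 1) * ((c + 1 - xp) * (c + 2 - xq))) := by rw [hXp]; ring
      _ ≤ vq * (xq * (xp - 1) * ((c + 1 - xq) * (c + 2 - xp))) := by linarith
      _ = (Xq * (xq - 1)) * ((c + 2 - xp) * (xq * (xp - 1))) := by rw [hXq]; ring
      _ = _ := by ring
  refine ⟨?_, key⟩
  by_contra! h
  nlinarith

theorem zero_one_order {c xq xp vq vp Xq Xp : ℝ} (hc : 0 < c) (hq : c + 2 ≤ xq) (hqp : xq < xp)
    (hvq : 1 ≤ vq) (hm : vp * xq ≤ vq * xp)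
    (hXp : Xp * (xp - 1) = vp * (xp - 1 - c)) (hXq : Xq * (xq - 1) = vq * (xq - 1 - c)) :
    Xp * (xq - c - 2) ≤ Xq * (xp - c - 2) := by
  have h1 : xp * (xq - 1) ≤ xq * (xp - 1) := by nlinarith
  have h2 : (xp - 1 - c) * (xq - c - 2) ≤ (xq - 1 - c) * (xp - c - 2) := by nlinarith
  have h3 := mul_le_mul h1 h2 (mul_nonneg (by linarith) (by linarith))
        (mul_nonneg (by linarith) (by linarith))
  have h4 := mul_le_mul_of_nonneg_right hm
    (mul_nonneg (by linarith : 0 ≤ xq - 1)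
      (mul_nonneg (by linarith : 0 ≤ xp - 1 - c) (by linarith : 0 ≤ xq - c - 2)))
  have h5 := mul_le_mul_of_nonneg_left h3 (by linarith : 0 ≤ vq)
  have hpos : 0 < xq * ((xp - 1) * (xq - 1)) :=
    mul_pos (by linarith) (mul_pos (by linarith) (by linarith))
  refine le_of_mul_le_mul_right ?_ hpos
  calc Xp * (xq - c - 2) * (xq * ((xp - 1) * (xq - 1)))
      = (Xp * (xp - 1)) * ((xq - c - 2) * xq * (xq - 1)) := by ring
    _ = vp * xq * ((xq - 1) * ((xp - 1 - c) * (xq - c - 2))) := by rw [hXp]; ring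
    _ ≤ vq * (xq * (xp - 1) * ((xq - 1 - c) * (xp - c - 2))) := by linarith
    _ = (Xq * (xq - 1)) * ((xp - c - 2) * (xq * (xp - 1))) := by rw [hXq]; ring
    _ = _ := by ring

/-- Here `s = -x` on the region `R₁`. -/
theorem one_zero_order {c sq sp yq yp Xq Xp : ℝ} (hc : 0 < c) (hsq : 0 ≤ sq) (hsp : 0 ≤ sp)
    (hyq : 0 ≤ yq) (hqp : yq < yp) (hn : sp * yq ≤ sq * yp)
    (hXp : Xp * (1 + sp) = yp * (1 + sp + c)) (hXq : Xq * (1 + sq) = yq * (1 + sq + c)) :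
    yp - yq ≤ Xp - Xq ∧ (c + 2 + sp) * Xq ≤ (c + 2 + sq) * Xp := by
  have hz : yq * (1 + sp) ≤ yp * (1 + sq) := by nlinarith
  have hpos : 0 < (1 + sp) * (1 + sq) := mul_pos (by linarith) (by linarith)
  constructor
  · refine le_of_mul_le_mul_right ?_ hpos
    have e : (Xp - Xq) * ((1 + sp) * (1 + sq)) =
        (Xp * (1 + sp)) * (1 + sq) - (Xq * (1 + sq)) * (1 + sp) := by ring
    rw [e, hXp, hXq]
    nlinarith [mul_le_mul_of_nonneg_left hz hc.le]
  · refine le_of_mul_le_mul_right ?_ hpos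
    have e1 : (c + 2 + sp) * Xq * ((1 + sp) * (1 + sq)) =
        (Xq * (1 + sq)) * ((c + 2 + sp) * (1 + sp)) := by ring
    have e2 : (c + 2 + sq) * Xp * ((1 + sp) * (1 + sq)) =
        (Xp * (1 + sp)) * ((c + 2 + sq) * (1 + sq)) := by ring
    rw [e1, e2, hXp, hXq]
    rcases le_total sp sq with h | h
    · have h1 : (1 + sq + c) * ((c + 2 + sp) * (1 + sp)) ≤
          (1 + sp + c) * ((c + 2 + sq) * (1 + sq)) := by
        have := mul_nonneg (sub_nonneg.2 h) hsq
        have := mul_nonneg (sub_nonneg.2 h) hsp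
        have := mul_nonneg (sub_nonneg.2 h) hc.le
        have := mul_nonneg (mul_nonneg (sub_nonneg.2 h) hsq) hsp
        have := mul_nonneg (mul_nonneg (sub_nonneg.2 h) hc.le) hsq
        have := mul_nonneg (mul_nonneg (sub_nonneg.2 h) hc.le) hsp
        have := mul_nonneg (mul_nonneg (sub_nonneg.2 h) hc.le) hc.le
        nlinarith
      have h2 := mul_le_mul_of_nonneg_left h1 hyq
      have h3 := mul_le_mul_of_nonneg_right hqp.le
        (mul_nonneg (by linarith : 0 ≤ 1 + sp + c)
          (mul_nonneg (by linarith : 0 ≤ c + 2 + sq) (by linarith : 0 ≤ 1 + sq)))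
      nlinarith
    · have hA : (1 + sq + c) * (c + 2 + sp) ≤ (1 + sp + c) * (c + 2 + sq) := by nlinarith
      have h2 := mul_le_mul hz hA (mul_nonneg (by linarith) (by linarith))
        (mul_nonneg (by linarith) (by linarith))
      nlinarith

theorem zero_zero_one_growth {c Vq Vp Xq Xp : ℝ} (hc : 0 < c)
    (hVp' : Vp ≤ c + 1) (hV : Vp < Vq) (hX : Xp < Xq) (hXp : c + 2 ≤ Xp)
    (hm : Vq * Xp ≤ Vp * Xq) :
    (1 + 1 / (c + 1) ^ 3) * (Vq - Vp) ≤ Xq - Xp := by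
  have h1 : (c + 2) * (Vq - Vp) ≤ (c + 1) * (Xq - Xp) := by nlinarith
  have h2 : (1 : ℝ) / (c + 1) ^ 3 ≤ 1 / (c + 1) := by
    apply one_div_le_one_div_of_le (by linarith)
    nlinarith [sq_nonneg c, pow_pos hc 3]
  have h3 : (1 + 1 / (c + 1)) * (Vq - Vp) ≤ Xq - Xp := by
    have e : (1 + 1 / (c + 1)) * (Vq - Vp) = (c + 2) * (Vq - Vp) / (c + 1) := by
      field_simp; ring
    rw [e, div_le_iff₀ (by linarith)]; linarith
  nlinarith

theorem zero_zero_zero_growth {c Vq Vp Xq Xp Zq Zp : ℝ} (hc : 0 < c)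
    (hVp' : Vp ≤ c + 1) (hV : Vp < Vq) (hX : Xp < Xq) (hXp : 1 < Xp) (hXq : Xq ≤ c + 1)
    (hm : Vq * Xp ≤ Vp * Xq)
    (hZp : Zp * (Xp - 1) = Vp * (c + 1 - Xp)) (hZq : Zq * (Xq - 1) = Vq * (c + 1 - Xq)) :
    (1 + 1 / (c + 1) ^ 3) * (Vq - Vp) ≤ Zp - Zq := by
  have h1 : Vq - Vp ≤ (c + 1) * (Xq - Xp) := by nlinarith
  have hp : 0 < Xp - 1 := by linarith
  have hq : 0 < Xq - 1 := by linarith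
  have hpq : 0 < (Xp - 1) * (Xq - 1) := mul_pos hp hq
  -- the gain `G` of the difference of first coordinates over two steps
  set G := (Zp - Zq) - (Vq - Vp) with hG
  have e : G * ((Xp - 1) * (Xq - 1)) = c * (Vp * (Xq - 1) - Vq * (Xp - 1)) := by
    have : G * ((Xp - 1) * (Xq - 1)) =
        (Zp * (Xp - 1)) * (Xq - 1) - (Zq * (Xq - 1)) * (Xp - 1)
          - (Vq - Vp) * ((Xp - 1) * (Xq - 1)) := by rw [hG]; ring
    rw [this, hZp, hZq]; ring
  have h2 : Vq - Vp ≤ Vp * (Xq - 1) - Vq * (Xp - 1) := by nlinarith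
  have h4 : (Xp - 1) * (Xq - 1) ≤ c * c := by nlinarith
  have hGpos : 0 ≤ G := by
    by_contra! h
    nlinarith [mul_pos hc (by linarith : 0 < Vp * (Xq - 1) - Vq * (Xp - 1)),
      mul_pos (neg_pos.2 h) hpq]
  have h5 : Vq - Vp ≤ G * c := by
    have : c * (Vq - Vp) ≤ c * (G * c) := by nlinarith [mul_le_mul_of_nonneg_left h4 hGpos]
    exact le_of_mul_le_mul_left this hc
  have h6 : 1 / (c + 1) ^ 3 * (Vq - Vp) ≤ G := by
    rw [one_div, inv_mul_le_iff₀ (by positivity)]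
    nlinarith [sq_nonneg c, pow_pos hc 3, mul_nonneg hGpos hc.le,
      mul_nonneg hGpos (sq_nonneg c), mul_nonneg hGpos (pow_pos hc 3).le]
  rw [hG] at h6
  linarith

/-- Here `u + 1` and `v` are coordinates of a point of `R₀`, `X + 1` and `T + c + 1` those of its
image after one visit to `R₁`. -/
theorem zero_one_zero_ratio {c u v X T : ℝ} (hc : 0 < c) (hu : c + 1 ≤ u) (hX : c + 1 ≤ X)
    (hv : 1 ≤ v) (hT : (T - 1) * u = v * (u - c)) (hXT : (X + 1) * T = (u - c - 1) * (T + c)) :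
    v / u + 1 / u ≤ (T + c + 1) / X ∧ X ≤ u - (c + 2) + c * (c + 1) / (v / u) := by
  have hu0 : 0 < u := by linarith
  have hT1 : 1 ≤ T := by
    by_contra! h
    nlinarith [mul_nonneg (by linarith : 0 ≤ v) (by linarith : 0 ≤ u - c)]
  have hd : 0 < u - c - 1 := by
    by_contra! h
    nlinarith
  set r := v / u with hr
  have hr0 : 0 < r := div_pos (by linarith) hu0
  have hvr : v = r * u := (div_mul_cancel₀ _ hu0.ne').symm
  have hTr : T = 1 + r * (u - c) := by
    have : (T - 1) * u = (r * (u - c)) * u := by rw [hT, hvr]; ring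
    have := mul_right_cancel₀ hu0.ne' this
    linarith
  constructor
  · have h1 : T / (u - c - 1) ≤ (T + c + 1) / X := by
      rw [div_le_div_iff₀ hd (by linarith)]
      nlinarith
    have h2 : T / (u - c - 1) = r + (1 + r) / (u - c - 1) := by
      rw [hTr]; field_simp; ring
    have h3 : 1 / u ≤ (1 + r) / (u - c - 1) := by
      rw [div_le_div_iff₀ hu0 hd]; nlinarith
    linarith
  · have h1 : X + 1 = (u - c - 1) + c * (u - c - 1) / T := by
      field_simp; linarith
    have h2 : c * (u - c - 1) / T ≤ c * (c + 1) / r := by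
      rw [div_le_div_iff₀ (by linarith) hr0, mul_assoc, mul_assoc]
      apply mul_le_mul_of_nonneg_left _ hc.le
      have : u * r ≤ (c + 1) * (r * (u - c)) := by
        nlinarith [mul_nonneg hr0.le hc.le,
          mul_nonneg (mul_nonneg hr0.le hc.le) (by linarith : 0 ≤ u - c - 1)]
      nlinarith [mul_nonneg hr0.le hc.le]
    linarith

/-- The recurrence followed by an orbit that alternates between `R₀` and `R₁` for all times has no
solution in `R₀`. -/
theorem alternating_recurrence_false {c : ℝ} (hc : 0 < c) (u v : ℕ → ℝ)
    (hu : ∀ j, c + 1 ≤ u j) (hv : ∀ j, 1 ≤ v j)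
    (hvs : ∀ j, (v (j + 1) - c - 2) * u j = v j * (u j - c))
    (hus : ∀ j, (u (j + 1) + 1) * (v (j + 1) - c - 1) = (u j - c - 1) * (v (j + 1) - 1)) :
    False := by
  have hU : ∀ j, 0 < u j := fun j => by linarith [hu j]
  set r : ℕ → ℝ := fun j => v j / u j with hr
  have hr0 : ∀ j, 0 < r j := fun j => div_pos (by linarith [hv j]) (hU j)
  have hstep : ∀ j, r j + 1 / u j ≤ r (j + 1) ∧
      u (j + 1) ≤ u j - (c + 2) + c * (c + 1) / r j := fun j => by
    have h := zero_one_zero_ratio (T := v (j + 1) - c - 1) hc (hu j) (hu (j + 1)) (hv j)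
      (by rw [← hvs j]; ring) (by rw [hus j]; ring)
    rw [show v (j + 1) - c - 1 + c + 1 = v (j + 1) by ring] at h
    exact h
  have hmono : Monotone r := monotone_nat_of_le_succ fun j => by
    have := (hstep j).1
    have : 0 < 1 / u j := one_div_pos.2 (hU j)
    linarith
  set C := c * (c + 1) / r 0 with hC
  have hC0 : 0 < C := div_pos (by positivity) (hr0 0)
  have hlin : ∀ j : ℕ, u j ≤ (u 0 + C) * (j + 1) := by
    intro j
    induction j with
    | zero => simp; linarith
    | succ j ih =>
      have h1 : c * (c + 1) / r j ≤ C :=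
        div_le_div_of_nonneg_left (by positivity) (hr0 0) (hmono (Nat.zero_le j))
      have := (hstep j).2
      have := hU 0
      push_cast
      linarith
  have hK : 0 < u 0 + C := by linarith [hU 0]
  have hsum : ∀ n : ℕ, (u 0 + C)⁻¹ * ∑ i ∈ Finset.range n, (1 : ℝ) / (i + 1) ≤ r n := by
    intro n
    induction n with
    | zero => simpa using (hr0 0).le
    | succ n ih =>
      rw [Finset.sum_range_succ, mul_add]
      have h1 : (u 0 + C)⁻¹ * (1 / ((n : ℝ) + 1)) ≤ 1 / u n := by
        rw [← one_div, one_div_mul_one_div]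
        exact one_div_le_one_div_of_le (hU n) (hlin n)
      linarith [(hstep n).1]
  obtain ⟨N, hN⟩ : ∃ N, c * (c + 1) ≤ r N := by
    have ht := Real.tendsto_sum_range_one_div_nat_succ_atTop
    obtain ⟨N, hN⟩ := (ht.eventually_ge_atTop (c * (c + 1) * (u 0 + C))).exists
    refine ⟨N, le_trans ?_ (hsum N)⟩
    rw [inv_mul_eq_div, le_div_iff₀ hK]
    exact hN
  have hdec : ∀ k : ℕ, u (N + k) ≤ u N - k := by
    intro k
    induction k with
    | zero => simp
    | succ k ih =>
      have h1 : c * (c + 1) / r (N + k) ≤ 1 := by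
        rw [div_le_one (hr0 _)]
        exact hN.trans (hmono (Nat.le_add_right _ _))
      have := (hstep (N + k)).2
      push_cast
      rw [← add_assoc]
      linarith
  obtain ⟨k, hk⟩ := exists_nat_gt (u N)
  linarith [hdec k, hU (N + k)]

/-! ### Itineraries -/

/-- The points whose forward itinerary up to time `N` is `w`. -/
def itinUpTo (a : ℝ) (w : ℕ → Fin 2) (N : ℕ) : Set (ℝ × ℝ) :=
  {p | ∀ n ≤ N, orbitDefined a p n ∧ (birat a)^[n] p ∈ Rw (w n)}

/-- The points whose forward itinerary is `w`. -/
def itin (a : ℝ) (w : ℕ → Fin 2) : Set (ℝ × ℝ) :=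
  {p | ∀ n : ℕ, orbitDefined a p n ∧ (birat a)^[n] p ∈ Rw (w n)}

theorem Fin.two_cases (i : Fin 2) : i = 0 ∨ i = 1 := by
  revert i; decide

theorem mem_Rw_zero {i : Fin 2} (hi : i = 0) {p : ℝ × ℝ} : p ∈ Rw i ↔ 1 ≤ p.1 ∧ p.2 ≤ -1 := by
  subst hi; simp [Rw, Rzero]

theorem mem_Rw_one {i : Fin 2} (hi : i = 1) {p : ℝ × ℝ} : p ∈ Rw i ↔ p.1 ≤ 0 ∧ 0 ≤ p.2 := by
  subst hi; simp [Rw, Rone]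

theorem orbitDefined_succ {a : ℝ} {p : ℝ × ℝ} {n : ℕ} :
    orbitDefined a p (n + 1) ↔ p.1 ≠ 1 ∧ orbitDefined a (birat a p) n := by
  constructor
  · intro h
    refine ⟨h 0 (by omega), fun k hk => ?_⟩
    rw [← Function.iterate_succ_apply]
    exact h (k + 1) (by omega)
  · rintro ⟨h0, h⟩ k hk
    cases k with
    | zero => exact h0
    | succ k =>
      rw [Function.iterate_succ_apply]
      exact h k (by omega)

theorem itinUpTo_succ {a : ℝ} {w : ℕ → Fin 2} {N : ℕ} {p : ℝ × ℝ} :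
    p ∈ itinUpTo a w (N + 1) ↔
      p ∈ Rw (w 0) ∧ p.1 ≠ 1 ∧ birat a p ∈ itinUpTo a (fun n => w (n + 1)) N := by
  constructor
  · intro h
    refine ⟨(h 0 (by omega)).2, (orbitDefined_succ.1 (h 1 (by omega)).1).1, fun n hn => ?_⟩
    have := h (n + 1) (by omega)
    rw [orbitDefined_succ, Function.iterate_succ_apply] at this
    exact ⟨this.1.2, this.2⟩
  · rintro ⟨h0, h1, h⟩ n hn
    cases n with
    | zero => exact ⟨fun k hk => absurd hk (by omega), h0⟩
    | succ n =>
      rw [orbitDefined_succ, Function.iterate_succ_apply]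
      have := h n (by omega)
      exact ⟨⟨h1, this.1⟩, this.2⟩

theorem mem_itin_iff_forall {a : ℝ} {w : ℕ → Fin 2} {p : ℝ × ℝ} :
    p ∈ itin a w ↔ ∀ N, p ∈ itinUpTo a w N :=
  ⟨fun h _ n _ => h n, fun h n => h n n le_rfl⟩

theorem itin_step {a : ℝ} {w : ℕ → Fin 2} {p : ℝ × ℝ} (h : p ∈ itin a w) :
    p ∈ Rw (w 0) ∧ p.1 ≠ 1 ∧ birat a p ∈ itin a (fun n => w (n + 1)) := by
  rw [mem_itin_iff_forall] at h
  refine ⟨(itinUpTo_succ.1 (h 1)).1, (itinUpTo_succ.1 (h 1)).2.1, ?_⟩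
  rw [mem_itin_iff_forall]
  exact fun N => (itinUpTo_succ.1 (h (N + 1))).2.2

theorem itin_mem {a : ℝ} {w : ℕ → Fin 2} {p : ℝ × ℝ} (h : p ∈ itin a w) : p ∈ Rw (w 0) :=
  (h 0).2

theorem itin_iterate {a : ℝ} {w : ℕ → Fin 2} {p : ℝ × ℝ} (h : p ∈ itin a w) (k : ℕ) :
    (birat a)^[k] p ∈ itin a (fun n => w (n + k)) := by
  induction k with
  | zero => exact h
  | succ k ih =>
    rw [Function.iterate_succ_apply']
    have := (itin_step ih).2.2
    simpa only [Nat.add_right_comm, add_assoc, add_comm, add_left_comm] using this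

theorem itinUpTo_anti {a : ℝ} {w : ℕ → Fin 2} {M N : ℕ} (h : M ≤ N) :
    itinUpTo a w N ⊆ itinUpTo a w M := fun _ hp n hn => hp n (hn.trans h)

/-- Admissible words. -/
def Adm (w : ℕ → Fin 2) : Prop := ∀ k : ℕ, ¬(w k = 1 ∧ w (k + 1) = 1)

theorem Adm.shift {w : ℕ → Fin 2} (h : Adm w) (k : ℕ) : Adm fun n => w (n + k) := fun n => by
  simpa only [Nat.add_right_comm] using h (n + k)

theorem birat_snd (c : ℝ) (p : ℝ × ℝ) : (birat (-(c + 1)) p).2 = p.1 - c - 2 := by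
  simp only [birat]; ring

theorem birat_fst_mul {c : ℝ} {p : ℝ × ℝ} (h : p.1 ≠ 1) :
    (birat (-(c + 1)) p).1 * (p.1 - 1) = p.2 * (p.1 - 1 - c) := by
  have : p.1 - 1 ≠ 0 := sub_ne_zero.2 h
  simp only [birat]
  field_simp
  ring

/-! ### Alternating words -/

theorem itin_alternating_false {c : ℝ} (hc : 0 < c) {w : ℕ → Fin 2} (h0 : w 0 = 0)
    (hw : ∀ n, w n ≠ w (n + 1)) {p : ℝ × ℝ} (hp : p ∈ itin (-(c + 1)) w) : False := by
  have hpar : ∀ j, w (2 * j) = 0 ∧ w (2 * j + 1) = 1 := by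
    intro j
    induction j with
    | zero =>
      refine ⟨h0, (Fin.two_cases _).resolve_left fun h => hw 0 ?_⟩
      rw [h0]; exact h.symm
    | succ j ih =>
      have h1 : w (2 * (j + 1)) = 0 := (Fin.two_cases _).resolve_right fun h => hw (2 * j + 1) <| by
        rw [ih.2]; exact h.symm
      refine ⟨h1, (Fin.two_cases _).resolve_left fun h => hw (2 * (j + 1)) ?_⟩
      rw [h1, h]
  set P : ℕ → ℝ × ℝ := fun n => (birat (-(c + 1)))^[n] p with hP
  have hmem : ∀ n, P n ∈ Rw (w n) := fun n => (hp n).2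
  have hne : ∀ n, (P n).1 ≠ 1 := fun n => (hp (n + 1)).1 n (by omega)
  have hsucc : ∀ n, P (n + 1) = birat (-(c + 1)) (P n) := fun n =>
    Function.iterate_succ_apply' _ _ _
  have hsnd : ∀ n, (P (n + 1)).2 = (P n).1 - c - 2 := fun n => by rw [hsucc, birat_snd]
  have hfst : ∀ n, (P (n + 1)).1 * ((P n).1 - 1) = (P n).2 * ((P n).1 - 1 - c) := fun n => by
    rw [hsucc, birat_fst_mul (hne n)]
  have hR0 : ∀ j, 1 ≤ (P (2 * j)).1 ∧ (P (2 * j)).2 ≤ -1 := fun j =>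
    (mem_Rw_zero (hpar j).1).1 (hmem _)
  have hR1 : ∀ j, (P (2 * j + 1)).1 ≤ 0 ∧ 0 ≤ (P (2 * j + 1)).2 := fun j =>
    (mem_Rw_one (hpar j).2).1 (hmem _)
  have hs : ∀ j, (P (2 * (j + 1))).2 = (P (2 * j + 1)).1 - c - 2 := fun j => hsnd (2 * j + 1)
  refine alternating_recurrence_false hc (fun j => (P (2 * j)).1 - 1) (fun j => -(P (2 * j)).2)
    (fun j => ?_) (fun j => ?_) (fun j => ?_) (fun j => ?_)
  · have := (hR1 j).2
    rw [hsnd] at this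
    linarith
  · linarith [(hR0 j).2]
  · have := hfst (2 * j)
    have := hs j
    simp only [this]
    linarith
  · have h1 : (P (2 * (j + 1))).1 * ((P (2 * j + 1)).1 - 1) =
      (P (2 * j + 1)).2 * ((P (2 * j + 1)).1 - 1 - c) := hfst (2 * j + 1)
    have h2 := hs j
    have h3 := hsnd (2 * j)
    rw [h3] at h1
    simp only [h2]
    linarith

/-! ### Points with the same itinerary -/

/-- `q` precedes `p` in `R₀`: `x` increases and `-y / x` does not increase. -/
def PrecZero (q p : ℝ × ℝ) : Prop := q.1 < p.1 ∧ -p.2 * q.1 ≤ -q.2 * p.1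

/-- `q` precedes `p` in `R₁`: `y` increases and `-x / y` does not increase. -/
def PrecOne (q p : ℝ × ℝ) : Prop := q.2 < p.2 ∧ -p.1 * q.2 ≤ -q.1 * p.2

theorem one_lt_of_itin {a : ℝ} {w : ℕ → Fin 2} (h0 : w 0 = 0) {p : ℝ × ℝ} (hp : p ∈ itin a w) :
    1 < p.1 ∧ p.2 ≤ -1 := by
  have h := (mem_Rw_zero h0).1 (itin_mem hp)
  exact ⟨lt_of_le_of_ne h.1 (itin_step hp).2.1.symm, h.2⟩

theorem PrecZero.zero {c : ℝ} {w : ℕ → Fin 2} (h0 : w 0 = 0) (h1 : w 1 = 0)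
    {q p : ℝ × ℝ} (hq : q ∈ itin (-(c + 1)) w) (hp : p ∈ itin (-(c + 1)) w)
    (h : PrecZero q p) : PrecZero (birat (-(c + 1)) p) (birat (-(c + 1)) q) := by
  have hp0 := one_lt_of_itin h0 hp
  have hq0 := one_lt_of_itin h0 hq
  have hp1 := one_lt_of_itin h1 (itin_step hp).2.2
  have ep := birat_fst_mul (c := c) hp0.1.ne'
  have eq := birat_fst_mul (c := c) hq0.1.ne'
  obtain ⟨h2, h3⟩ := zero_zero_order (c := c) hq0.1 h.1 (by linarith [hp0.2] : 1 ≤ -p.2)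
    (by linarith [hq0.2] : 1 ≤ -q.2) h.2 (by rw [ep]; ring) (by rw [eq]; ring) hp1.1.le
  refine ⟨h2, ?_⟩
  rw [birat_snd, birat_snd]
  linarith

theorem PrecZero.one {c : ℝ} (hc : 0 < c) {w : ℕ → Fin 2} (h0 : w 0 = 0) (h1 : w 1 = 1)
    {q p : ℝ × ℝ} (hq : q ∈ itin (-(c + 1)) w) (hp : p ∈ itin (-(c + 1)) w)
    (h : PrecZero q p) : PrecOne (birat (-(c + 1)) q) (birat (-(c + 1)) p) := by
  have hp0 := one_lt_of_itin h0 hp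
  have hq0 := one_lt_of_itin h0 hq
  have hq1 := (mem_Rw_one h1).1 (itin_mem (itin_step hq).2.2)
  have ep := birat_fst_mul (c := c) hp0.1.ne'
  have eq := birat_fst_mul (c := c) hq0.1.ne'
  rw [birat_snd] at hq1
  have h2 := zero_one_order (Xp := -(birat (-(c + 1)) p).1) (Xq := -(birat (-(c + 1)) q).1) hc
    (by linarith [hq1.2] : c + 2 ≤ q.1) h.1 (by linarith [hq0.2] : 1 ≤ -q.2) h.2
    (by rw [neg_mul, ep]; ring) (by rw [neg_mul, eq]; ring)
  refine ⟨?_, ?_⟩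
  · rw [birat_snd, birat_snd]
    linarith [h.1]
  · rw [birat_snd, birat_snd]
    exact h2

theorem PrecOne.zero {c : ℝ} (hc : 0 < c) {w : ℕ → Fin 2} (h0 : w 0 = 1)
    {q p : ℝ × ℝ} (hq : q ∈ itin (-(c + 1)) w) (hp : p ∈ itin (-(c + 1)) w)
    (h : PrecOne q p) :
    PrecZero (birat (-(c + 1)) q) (birat (-(c + 1)) p) ∧
      p.2 - q.2 ≤ (birat (-(c + 1)) p).1 - (birat (-(c + 1)) q).1 := by
  have hp0 := (mem_Rw_one h0).1 (itin_mem hp)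
  have hq0 := (mem_Rw_one h0).1 (itin_mem hq)
  have ep := birat_fst_mul (c := c) (itin_step hp).2.1
  have eq := birat_fst_mul (c := c) (itin_step hq).2.1
  obtain ⟨h2, h3⟩ := one_zero_order (sp := -p.1) (sq := -q.1) (Xp := (birat (-(c + 1)) p).1)
    (Xq := (birat (-(c + 1)) q).1) hc (by linarith [hq0.1]) (by linarith [hp0.1]) hq0.2 h.1 h.2
    (by linarith) (by linarith)
  refine ⟨⟨by linarith [h.1], ?_⟩, h2⟩
  rw [birat_snd, birat_snd]
  linarith

/-- Words with infinitely many repetitions, i.e. not eventually alternating. -/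
def RepeatsOften (w : ℕ → Fin 2) : Prop := ∀ K : ℕ, ∃ n : ℕ, K ≤ n ∧ w n = w (n + 1)

theorem RepeatsOften.shift {w : ℕ → Fin 2} (h : RepeatsOften w) (k : ℕ) :
    RepeatsOften fun n => w (n + k) := fun K => by
  obtain ⟨n, hn, hw⟩ := h (K + k)
  refine ⟨n - k, by omega, ?_⟩
  have e1 : n - k + k = n := by omega
  have e2 : n - k + 1 + k = n + 1 := by omega
  simpa only [e1, e2] using hw

theorem PrecZero.expansion {c : ℝ} (hc : 0 < c) (k : ℕ) :
    ∀ {w : ℕ → Fin 2}, Adm w → RepeatsOften w → w 0 = 0 → ∀ {q p : ℝ × ℝ},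
      q ∈ itin (-(c + 1)) w → p ∈ itin (-(c + 1)) w → PrecZero q p →
      (1 + 1 / (c + 1) ^ 3) ^ k * (p.1 - q.1) ≤ c := by
  have hl : 0 < 1 + 1 / (c + 1) ^ 3 := by positivity
  induction k with
  | zero =>
    intro w hw hr h0 q p hq hp h
    obtain ⟨m, -, hm⟩ := hr 0
    rw [pow_zero, one_mul]
    induction m using Nat.strong_induction_on generalizing w q p with
    | _ m ihm =>
    have hq0 := one_lt_of_itin h0 hq
    rcases Fin.two_cases (w 1) with h1 | h1
    · have hp1 := one_lt_of_itin h1 (itin_step hp).2.2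
      rw [birat_snd] at hp1
      linarith
    · have h2 : w 2 = 0 := (Fin.two_cases _).resolve_right fun h2 => hw 1 ⟨h1, h2⟩
      obtain ⟨j, rfl⟩ : ∃ j, m = j + 2 := by
        match m, hm with
        | 0, hm => rw [h0] at hm; exact absurd (hm.trans h1) (by decide)
        | 1, hm => rw [h1] at hm; exact absurd (hm.trans h2) (by decide)
        | j + 2, _ => exact ⟨j, rfl⟩
      obtain ⟨h3, h4⟩ := (h.one hc h0 h1 hq hp).zero hc h1 (itin_step hq).2.2 (itin_step hp).2.2
      have := ihm j (by omega) (hw.shift 2) (hr.shift 2) h2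
        (itin_step (itin_step hq).2.2).2.2 (itin_step (itin_step hp).2.2).2.2 h3 hm
      rw [birat_snd, birat_snd] at h4
      linarith
  | succ k ih =>
    intro w hw hr h0 q p hq hp h
    obtain ⟨m, -, hm⟩ := hr 0
    induction m using Nat.strong_induction_on generalizing w q p with
    | _ m ihm =>
    have hq0 := one_lt_of_itin h0 hq
    have hp0 := one_lt_of_itin h0 hp
    rcases Fin.two_cases (w 1) with h1 | h1
    · have hq' := (itin_step hq).2.2
      have hp' := (itin_step hp).2.2
      have hp1 := one_lt_of_itin h1 hp'
      have hq1 := one_lt_of_itin h1 hq'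
      have h' := h.zero h0 h1 hq hp
      have hm' := h'.2
      have eq2 := birat_fst_mul (c := c) hq1.1.ne'
      have ep2 := birat_fst_mul (c := c) hp1.1.ne'
      rw [birat_snd] at hp1 hq1
      rw [birat_snd, birat_snd] at hm'
      rw [birat_snd] at eq2 ep2
      have hm'' : (c + 2 - q.1) * (birat (-(c + 1)) p).1 ≤
          (c + 2 - p.1) * (birat (-(c + 1)) q).1 := by linarith
      rw [pow_succ, mul_assoc]
      rcases Fin.two_cases (w 2) with h2 | h2
      · have hq2 := one_lt_of_itin h2 (itin_step hq').2.2
        rw [birat_snd] at hq2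
        have hg := zero_zero_zero_growth (Vp := c + 2 - p.1) (Vq := c + 2 - q.1) hc
          (by linarith) (by linarith [h.1]) h'.1 hp1.1 (by linarith) hm''
          (by rw [ep2]; ring) (by rw [eq2]; ring)
        rw [show c + 2 - q.1 - (c + 2 - p.1) = p.1 - q.1 by ring] at hg
        exact (mul_le_mul_of_nonneg_left hg (pow_pos hl k).le).trans
          (ih (hw.shift 2) (hr.shift 2) h2 (itin_step hq').2.2 (itin_step hp').2.2
            (h'.zero h1 h2 hp' hq'))
      · have hp2 := (mem_Rw_one h2).1 (itin_mem (itin_step hp').2.2)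
        rw [birat_snd] at hp2
        have hg := zero_zero_one_growth (Vp := c + 2 - p.1) (Vq := c + 2 - q.1) hc
          (by linarith) (by linarith [h.1]) h'.1 (by linarith) hm''
        rw [show c + 2 - q.1 - (c + 2 - p.1) = p.1 - q.1 by ring] at hg
        exact (mul_le_mul_of_nonneg_left hg (pow_pos hl k).le).trans
          (ih (hw.shift 1) (hr.shift 1) h1 hp' hq' h')
    · have h2 : w 2 = 0 := (Fin.two_cases _).resolve_right fun h2 => hw 1 ⟨h1, h2⟩
      obtain ⟨j, rfl⟩ : ∃ j, m = j + 2 := by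
        match m, hm with
        | 0, hm => rw [h0] at hm; exact absurd (hm.trans h1) (by decide)
        | 1, hm => rw [h1] at hm; exact absurd (hm.trans h2) (by decide)
        | j + 2, _ => exact ⟨j, rfl⟩
      obtain ⟨h3, h4⟩ := (h.one hc h0 h1 hq hp).zero hc h1 (itin_step hq).2.2 (itin_step hp).2.2
      have h5 := ihm j (by omega) (hw.shift 2) (hr.shift 2) h2
        (itin_step (itin_step hq).2.2).2.2 (itin_step (itin_step hp).2.2).2.2 h3 hm
      rw [birat_snd, birat_snd] at h4
      refine (mul_le_mul_of_nonneg_left ?_ (pow_pos hl (k + 1)).le).trans h5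
      linarith

theorem not_precZero {c : ℝ} (hc : 0 < c) {w : ℕ → Fin 2} (hw : Adm w) (hr : RepeatsOften w)
    (h0 : w 0 = 0) {q p : ℝ × ℝ} (hq : q ∈ itin (-(c + 1)) w) (hp : p ∈ itin (-(c + 1)) w) :
    ¬PrecZero q p := by
  intro h
  have hd : 0 < p.1 - q.1 := sub_pos.2 h.1
  have hl : (1 : ℝ) < 1 + 1 / (c + 1) ^ 3 := by
    have : 0 < 1 / (c + 1) ^ 3 := by positivity
    linarith
  obtain ⟨k, hk⟩ := pow_unbounded_of_one_lt (c / (p.1 - q.1)) hl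
  rw [div_lt_iff₀ hd] at hk
  exact absurd (PrecZero.expansion hc k hw hr h0 hq hp h) (not_le.2 hk)

theorem itin_eq_empty_of_not_repeatsOften {c : ℝ} (hc : 0 < c) {w : ℕ → Fin 2} (hw : Adm w)
    (hr : ¬RepeatsOften w) {p : ℝ × ℝ} (hp : p ∈ itin (-(c + 1)) w) : False := by
  simp only [RepeatsOften, not_forall, not_exists, not_and] at hr
  obtain ⟨K, hK⟩ := hr
  rcases Fin.two_cases (w K) with h | h
  · refine itin_alternating_false hc (w := fun n => w (n + K)) ?_ ?_ (itin_iterate hp K)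
    · simpa using h
    · intro n
      simpa only [Nat.add_right_comm] using hK (n + K) (by omega)
  · refine itin_alternating_false hc (w := fun n => w (n + (K + 1))) ?_ ?_ (itin_iterate hp (K + 1))
    · simpa using (Fin.two_cases _).resolve_right fun h2 => hw K ⟨h, h2⟩
    · intro n
      simpa only [Nat.add_right_comm] using hK (n + (K + 1)) (by omega)

theorem itin_not_lt {c : ℝ} (hc : 0 < c) {w : ℕ → Fin 2} (hw : Adm w)
    {q p : ℝ × ℝ} (hq : q ∈ itin (-(c + 1)) w) (hp : p ∈ itin (-(c + 1)) w)
    (h1 : q.1 < p.1) (h2 : q.2 < p.2) : False := by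
  have hr : RepeatsOften w := by
    by_contra hr
    exact itin_eq_empty_of_not_repeatsOften hc hw hr hp
  rcases Fin.two_cases (w 0) with h0 | h0
  · have hp0 := one_lt_of_itin h0 hp
    have hq0 := one_lt_of_itin h0 hq
    exact not_precZero hc hw hr h0 hq hp ⟨h1, by nlinarith⟩
  · have hp0 := (mem_Rw_one h0).1 (itin_mem hp)
    have hq0 := (mem_Rw_one h0).1 (itin_mem hq)
    have h : PrecOne q p := ⟨h2, by nlinarith⟩
    exact not_precZero hc (hw.shift 1) (hr.shift 1)
      ((Fin.two_cases _).resolve_right fun h => hw 0 ⟨h0, h⟩)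
      (itin_step hq).2.2 (itin_step hp).2.2 (h.zero hc h0 hq hp).1

theorem itin_antitone {c : ℝ} (hc : 0 < c) {w : ℕ → Fin 2} (hw : Adm w)
    {p q : ℝ × ℝ} (hp : p ∈ itin (-(c + 1)) w) (hq : q ∈ itin (-(c + 1)) w) :
    (p.1 - q.1) * (p.2 - q.2) ≤ 0 := by
  by_contra! h
  rcases mul_pos_iff.1 h with h | h
  · exact itin_not_lt hc hw hq hp (by linarith) (by linarith)
  · exact itin_not_lt hc hw hp hq (by linarith) (by linarith)

theorem interior_eq_empty_of_antitone {S : Set (ℝ × ℝ)}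
    (h : ∀ p ∈ S, ∀ q ∈ S, (p.1 - q.1) * (p.2 - q.2) ≤ 0) : interior S = ∅ := by
  rw [Set.eq_empty_iff_forall_notMem]
  intro p hp
  obtain ⟨ε, hε, hb⟩ := Metric.isOpen_iff.1 isOpen_interior p hp
  have hq : (p.1 + ε / 2, p.2 + ε / 2) ∈ S := by
    apply interior_subset (hb _)
    rw [Metric.mem_ball, Prod.dist_eq, Real.dist_eq, Real.dist_eq]
    simp only [add_sub_cancel_left, max_self]
    rw [abs_of_pos (by linarith)]
    linarith
  have := h _ hq p (interior_subset hp)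
  simp only [add_sub_cancel_left] at this
  nlinarith

/-! ### Crossing paths -/

theorem exists_subpath_of_le {h : ℝ → ℝ} (hh : ContinuousOn h (Set.Icc 0 1)) {A B : ℝ}
    (hAB : A ≤ B) (h0 : h 0 ≤ A) (h1 : B ≤ h 1) :
    ∃ σ : ℝ → ℝ, Continuous σ ∧ Set.MapsTo σ (Set.Icc 0 1) (Set.Icc 0 1) ∧ h (σ 0) = A ∧
      h (σ 1) = B ∧ ∀ t ∈ Set.Icc (0 : ℝ) 1, h (σ t) ∈ Set.Icc A B := by
  have hcl : ∀ (u v y : ℝ), Set.Icc u v ⊆ Set.Icc 0 1 →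
      IsCompact (Set.Icc u v ∩ h ⁻¹' {y}) := fun u v y huv =>
    isCompact_Icc.of_isClosed_subset
      ((hh.mono huv).preimage_isClosed_of_isClosed isClosed_Icc isClosed_singleton)
      Set.inter_subset_left
  obtain ⟨t, ⟨ht, htB⟩, htmin⟩ := (hcl 0 1 B subset_rfl).exists_isLeast <| by
    obtain ⟨t, ht, e⟩ := intermediate_value_Icc zero_le_one hh ⟨h0.trans hAB, h1⟩
    exact ⟨t, ht, e⟩
  have hsub : Set.Icc 0 t ⊆ Set.Icc (0 : ℝ) 1 := Set.Icc_subset_Icc_right ht.2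
  obtain ⟨s, ⟨hs, hsA⟩, hsmax⟩ := (hcl 0 t A hsub).exists_isGreatest <| by
    obtain ⟨s, hs, e⟩ := intermediate_value_Icc ht.1 (hh.mono hsub)
      ⟨h0, hAB.trans (Set.mem_singleton_iff.1 htB).ge⟩
    exact ⟨s, hs, e⟩
  have htB' : h t = B := htB
  have hsA' : h s = A := hsA
  have hIcc : ∀ r ∈ Set.Icc s t, h r ∈ Set.Icc A B := by
    intro r hr
    have hr1 : r ≤ 1 := hr.2.trans ht.2
    have hr0 : 0 ≤ r := hs.1.trans hr.1
    constructor
    · by_contra! hlt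
      obtain ⟨r', hr', e⟩ := intermediate_value_Icc hr.2
        (hh.mono (Set.Icc_subset_Icc hr0 ht.2)) ⟨hlt.le, by rw [htB']; exact hAB⟩
      have := hsmax ⟨⟨hr0.trans hr'.1, hr'.2⟩, e⟩
      have e' : r = s := le_antisymm (hr'.1.trans this) hr.1
      rw [e', hsA'] at hlt
      exact lt_irrefl _ hlt
    · by_contra! hlt
      obtain ⟨r', hr', e⟩ := intermediate_value_Icc hr0
        (hh.mono (Set.Icc_subset_Icc_right hr1)) ⟨h0.trans hAB, hlt.le⟩
      have := htmin ⟨⟨hr'.1, hr'.2.trans hr1⟩, e⟩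
      have e' : r = t := le_antisymm hr.2 (this.trans hr'.2)
      rw [e', htB'] at hlt
      exact lt_irrefl _ hlt
  have hσ : ∀ r ∈ Set.Icc (0 : ℝ) 1, s + (t - s) * r ∈ Set.Icc s t := fun r hr => by
    have := hs.2
    constructor <;> nlinarith [hr.1, hr.2]
  refine ⟨fun r => s + (t - s) * r, by fun_prop, fun r hr => ?_, by simpa using hsA',
    by simpa using htB', fun r hr => hIcc _ (hσ r hr)⟩
  exact ⟨hs.1.trans (hσ r hr).1, (hσ r hr).2.trans ht.2⟩

theorem exists_subpath_of_ge {h : ℝ → ℝ} (hh : ContinuousOn h (Set.Icc 0 1)) {A B : ℝ}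
    (hAB : A ≤ B) (h1 : h 1 ≤ A) (h0 : B ≤ h 0) :
    ∃ σ : ℝ → ℝ, Continuous σ ∧ Set.MapsTo σ (Set.Icc 0 1) (Set.Icc 0 1) ∧ h (σ 0) = A ∧
      h (σ 1) = B ∧ ∀ t ∈ Set.Icc (0 : ℝ) 1, h (σ t) ∈ Set.Icc A B := by
  have hrev : Set.MapsTo (fun t : ℝ => 1 - t) (Set.Icc 0 1) (Set.Icc 0 1) := fun t ht =>
    ⟨by linarith [ht.2], by linarith [ht.1]⟩
  obtain ⟨σ, hσ, hm, e0, e1, hI⟩ := exists_subpath_of_le (h := fun t => h (1 - t))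
    (hh.comp (by fun_prop) hrev) hAB (by simpa using h1) (by simpa using h0)
  exact ⟨fun t => 1 - σ t, by fun_prop, fun t ht => hrev (hm ht), e0, e1, hI⟩

/-- The coordinate, vanishing on one side of the quadrant `R_i`, that increases along crossing
paths. -/
def gap (i : Fin 2) (p : ℝ × ℝ) : ℝ := if i = 0 then p.1 - 1 else p.2

theorem gap_zero {i : Fin 2} (hi : i = 0) (p : ℝ × ℝ) : gap i p = p.1 - 1 := if_pos hi

theorem gap_one {i : Fin 2} (hi : i = 1) (p : ℝ × ℝ) : gap i p = p.2 := by
  subst hi; rfl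

theorem continuous_gap (i : Fin 2) : Continuous (gap i) := by
  rcases Fin.two_cases i with rfl | rfl
  · exact continuous_fst.sub continuous_const
  · exact continuous_snd

theorem continuousAt_birat {a : ℝ} {p : ℝ × ℝ} (hp : p.1 ≠ 1) : ContinuousAt (birat a) p := by
  have : p.1 - 1 ≠ 0 := sub_ne_zero.2 hp
  unfold birat
  fun_prop (disch := assumption)

/-- Every path in the first region along which `gap` runs from `0` to `B` meets
`itinUpTo a w N`. -/
def Crosses (a : ℝ) (w : ℕ → Fin 2) (N : ℕ) (B : ℝ) : Prop :=
  ∀ P : ℝ → ℝ × ℝ, ContinuousOn P (Set.Icc 0 1) → (∀ t ∈ Set.Icc (0 : ℝ) 1, P t ∈ Rw (w 0)) →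
    gap (w 0) (P 0) = 0 → gap (w 0) (P 1) = B → ∃ t ∈ Set.Icc (0 : ℝ) 1, P t ∈ itinUpTo a w N

theorem Crosses.exists_mem_of_image {a : ℝ} {w : ℕ → Fin 2} {N : ℕ} {B : ℝ} (hB : 0 ≤ B)
    (hC : Crosses a (fun n => w (n + 1)) N B) {P : ℝ → ℝ × ℝ} (hP : ContinuousOn P (Set.Icc 0 1))
    (hR : ∀ t ∈ Set.Icc (0 : ℝ) 1, P t ∈ Rw (w 0)) (h1 : ∀ t ∈ Set.Icc (0 : ℝ) 1, (P t).1 ≠ 1)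
    (hg : (gap (w 1) (birat a (P 0)) ≤ 0 ∧ B ≤ gap (w 1) (birat a (P 1))) ∨
      (gap (w 1) (birat a (P 1)) ≤ 0 ∧ B ≤ gap (w 1) (birat a (P 0))))
    (hR' : ∀ t ∈ Set.Icc (0 : ℝ) 1, 0 ≤ gap (w 1) (birat a (P t)) → birat a (P t) ∈ Rw (w 1)) :
    ∃ t ∈ Set.Icc (0 : ℝ) 1, P t ∈ itinUpTo a w (N + 1) := by
  have hQ : ContinuousOn (fun t => birat a (P t)) (Set.Icc 0 1) := fun t ht =>
    (continuousAt_birat (h1 t ht)).comp_continuousWithinAt (hP t ht)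
  have hgc := (continuous_gap (w 1)).comp_continuousOn hQ
  obtain ⟨σ, hσ, hm, e0, e1, hI⟩ :
      ∃ σ : ℝ → ℝ, Continuous σ ∧ Set.MapsTo σ (Set.Icc 0 1) (Set.Icc 0 1) ∧
        gap (w 1) (birat a (P (σ 0))) = 0 ∧ gap (w 1) (birat a (P (σ 1))) = B ∧
        ∀ t ∈ Set.Icc (0 : ℝ) 1, gap (w 1) (birat a (P (σ t))) ∈ Set.Icc 0 B := by
    rcases hg with hg | hg
    · exact exists_subpath_of_le hgc hB hg.1 hg.2
    · exact exists_subpath_of_ge hgc hB hg.1 hg.2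
  obtain ⟨t, ht, h⟩ := hC (fun t => birat a (P (σ t))) (hQ.comp hσ.continuousOn hm)
    (fun t ht => hR' _ (hm ht) (hI t ht).1) e0 e1
  exact ⟨σ t, hm ht, itinUpTo_succ.2 ⟨hR _ (hm ht), h1 _ (hm ht), h⟩⟩

theorem exists_crosses {c : ℝ} (hc : 0 < c) (N : ℕ) :
    ∀ {w : ℕ → Fin 2}, Adm w → ∃ B, 0 ≤ B ∧ Crosses (-(c + 1)) w N B := by
  induction N with
  | zero =>
    intro w _
    refine ⟨0, le_rfl, fun P _ hR _ _ => ⟨0, by simp, fun n hn => ?_⟩⟩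
    obtain rfl : n = 0 := by omega
    exact ⟨fun k hk => absurd hk (by omega), hR 0 (by simp)⟩
  | succ N ih =>
    intro w hw
    obtain ⟨B, hB, hC⟩ := ih (hw.shift 1)
    rcases Fin.two_cases (w 0) with h0 | h0
    · rcases Fin.two_cases (w 1) with h1 | h1
      · refine ⟨c, hc.le, fun P hP hR e0 e1 => ?_⟩
        have hδ : 0 < c / (B + 2) := by positivity
        have hδB : c / (B + 2) * (B + 2) = c := by field_simp
        obtain ⟨σ, hσ, hm, f0, f1, hI⟩ := exists_subpath_of_le (A := c / (B + 2)) (B := c)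
          ((continuous_gap (w 0)).comp_continuousOn hP) (by nlinarith)
          (by simpa [e0] using hδ.le) e1.ge
        simp only [Function.comp_apply, gap_zero h0] at f0 f1 hI
        have hne : ∀ t ∈ Set.Icc (0 : ℝ) 1, (P (σ t)).1 ≠ 1 := fun t ht h => by
          have := (hI t ht).1
          rw [h] at this
          linarith
        have m0 := (mem_Rw_zero h0).1 (hR _ (hm (Set.left_mem_Icc.2 zero_le_one)))
        have r0 := birat_fst_mul (c := c) (hne 0 (by simp))
        have r1 := birat_fst_mul (c := c) (hne 1 (by simp))
        rw [f0] at r0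
        rw [f1, sub_self, mul_zero] at r1
        suffices ∃ t ∈ Set.Icc (0 : ℝ) 1, P (σ t) ∈ itinUpTo (-(c + 1)) w (N + 1) by
          obtain ⟨t, ht, h⟩ := this
          exact ⟨σ t, hm ht, h⟩
        refine hC.exists_mem_of_image hB (P := fun t => P (σ t))
          (hP.comp hσ.continuousOn hm) (fun t ht => hR _ (hm ht)) hne (Or.inr ⟨?_, ?_⟩) ?_
        · rw [gap_zero h1]
          have := (mul_eq_zero.1 r1).resolve_right hc.ne'
          linarith
        · rw [gap_zero h1]
          have : (B + 1) * (c / (B + 2)) ≤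
              (birat (-(c + 1)) (P (σ 0))).1 * (c / (B + 2)) := by
            have hdc : 0 ≤ c - c / (B + 2) := by nlinarith
            have hy : 0 ≤ -(P (σ 0)).2 - 1 := by linarith [m0.2]
            rw [r0]
            linarith [mul_nonneg hy hdc]
          linarith [le_of_mul_le_mul_right this hδ]
        · intro t ht h
          rw [gap_zero h1] at h
          rw [mem_Rw_zero h1, birat_snd]
          exact ⟨by linarith, by linarith [(hI t ht).2]⟩
      · refine ⟨B + c + 1, by linarith, fun P hP hR e0 e1 => ?_⟩
        obtain ⟨σ, hσ, hm, f0, f1, hI⟩ := exists_subpath_of_le (A := c + 1) (B := B + c + 1)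
          ((continuous_gap (w 0)).comp_continuousOn hP) (by linarith)
          (by simp only [Function.comp_apply, e0]; linarith) e1.ge
        simp only [Function.comp_apply, gap_zero h0] at f0 f1 hI
        have hne : ∀ t ∈ Set.Icc (0 : ℝ) 1, (P (σ t)).1 ≠ 1 := fun t ht h => by
          have := (hI t ht).1
          rw [h] at this
          linarith
        suffices ∃ t ∈ Set.Icc (0 : ℝ) 1, P (σ t) ∈ itinUpTo (-(c + 1)) w (N + 1) by
          obtain ⟨t, ht, h⟩ := this
          exact ⟨σ t, hm ht, h⟩
        refine hC.exists_mem_of_image hB (P := fun t => P (σ t))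
          (hP.comp hσ.continuousOn hm) (fun t ht => hR _ (hm ht)) hne (Or.inl ⟨?_, ?_⟩) ?_
        · rw [gap_one h1, birat_snd]; linarith
        · rw [gap_one h1, birat_snd]; linarith
        · intro t ht h
          rw [gap_one h1] at h
          refine (mem_Rw_one h1).2 ⟨?_, h⟩
          have r := birat_fst_mul (c := c) (hne t ht)
          have := (hI t ht).1
          have := (mem_Rw_zero h0).1 (hR _ (hm ht))
          by_contra! hpos
          have := mul_pos hpos (show 0 < (P (σ t)).1 - 1 by linarith)
          nlinarith
    · have h1 : w 1 = 0 := (Fin.two_cases _).resolve_right fun h1 => hw 0 ⟨h0, h1⟩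
      refine ⟨B + 1, by linarith, fun P hP hR e0 e1 => ?_⟩
      have hm : ∀ t ∈ Set.Icc (0 : ℝ) 1, (P t).1 ≤ 0 ∧ 0 ≤ (P t).2 := fun t ht =>
        (mem_Rw_one h0).1 (hR t ht)
      have hne : ∀ t ∈ Set.Icc (0 : ℝ) 1, (P t).1 ≠ 1 := fun t ht h => by
        have := (hm t ht).1
        linarith
      rw [gap_one h0] at e0 e1
      refine hC.exists_mem_of_image hB hP hR hne (Or.inl ⟨?_, ?_⟩) ?_
      · have r := birat_fst_mul (c := c) (hne 0 (by simp))
        rw [e0, zero_mul] at r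
        rw [gap_zero h1]
        have := (mul_eq_zero.1 r).resolve_right (sub_ne_zero.2 (hne 0 (by simp)))
        linarith
      · have r := birat_fst_mul (c := c) (hne 1 (by simp))
        have := hm 1 (by simp)
        rw [gap_zero h1]
        by_contra! hlt
        rw [e1] at r
        nlinarith
      · intro t ht h
        rw [gap_zero h1] at h
        rw [mem_Rw_zero h1, birat_snd]
        exact ⟨by linarith, by linarith [(hm t ht).1]⟩

/-- The points on the part of the boundary line of `R_i` with `gap i = s`. -/
def edge (i : Fin 2) (s : ℝ) : ℝ × ℝ := if i = 0 then (s + 1, -1) else (0, s)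

theorem continuous_edge (i : Fin 2) : Continuous (edge i) := by
  rcases Fin.two_cases i with rfl | rfl
  · exact (continuous_id.add continuous_const).prodMk continuous_const
  · exact continuous_const.prodMk continuous_id

theorem gap_edge (i : Fin 2) (s : ℝ) : gap i (edge i s) = s := by
  rcases Fin.two_cases i with rfl | rfl <;> simp [gap, edge]

theorem edge_mem_Rw (i : Fin 2) {s : ℝ} (hs : 0 ≤ s) : edge i s ∈ Rw i := by
  rcases Fin.two_cases i with rfl | rfl <;> simpa [Rw, edge, Rzero, Rone] using hs

theorem exists_edge_mem_itinUpTo {c : ℝ} (hc : 0 < c) {w : ℕ → Fin 2} (hw : Adm w) (N : ℕ) :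
    ∃ s, 0 ≤ s ∧ edge (w 0) s ∈ itinUpTo (-(c + 1)) w N := by
  obtain ⟨B, hB, hC⟩ := exists_crosses hc N hw
  obtain ⟨t, ht, h⟩ := hC (fun t => edge (w 0) (t * B))
    ((continuous_edge _).comp (by fun_prop)).continuousOn
    (fun t ht => edge_mem_Rw _ (mul_nonneg ht.1 hB)) (by simp [gap_edge]) (by simp [gap_edge])
  exact ⟨_, mul_nonneg ht.1 hB, h⟩

/-! ### Bounds on points with prescribed itinerary -/

theorem exists_fst_le {c : ℝ} (hc : 0 < c) (m : ℕ) :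
    ∀ {w : ℕ → Fin 2}, Adm w → w 0 = 0 → w m = w (m + 1) →
      ∃ (B : ℝ) (N : ℕ), ∀ p ∈ itinUpTo (-(c + 1)) w N, p.1 ≤ B := by
  induction m using Nat.strong_induction_on with
  | _ m ih =>
  intro w hw h0 hm
  rcases Fin.two_cases (w 1) with h1 | h1
  · refine ⟨c + 1, 1, fun p hp => ?_⟩
    have := (mem_Rw_zero h1).1 ((itinUpTo_succ.1 hp).2.2 0 le_rfl).2
    rw [Function.iterate_zero_apply, birat_snd] at this
    linarith
  · have h2 : w 2 = 0 := (Fin.two_cases _).resolve_right fun h2 => hw 1 ⟨h1, h2⟩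
    obtain ⟨j, rfl⟩ : ∃ j, m = j + 2 := by
      match m, hm with
      | 0, hm => rw [h0] at hm; exact absurd (hm.trans h1) (by decide)
      | 1, hm => rw [h1] at hm; exact absurd (hm.trans h2) (by decide)
      | j + 2, _ => exact ⟨j, rfl⟩
    obtain ⟨B, N, hB⟩ := ih j (by omega) (hw.shift 2) h2 hm
    refine ⟨B + c + 2, N + 2, fun p hp => ?_⟩
    obtain ⟨-, -, hp1⟩ := itinUpTo_succ.1 hp
    obtain ⟨m1, n1, hp2⟩ := itinUpTo_succ.1 hp1
    have := hB _ hp2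
    have r := birat_fst_mul (c := c) n1
    have m1' := (mem_Rw_one h1).1 m1
    rw [birat_snd] at r m1'
    by_contra! hlt
    nlinarith

theorem exists_gap_le {c : ℝ} (hc : 0 < c) {w : ℕ → Fin 2} (hw : Adm w) (hr : RepeatsOften w) :
    ∃ (B : ℝ) (N : ℕ), ∀ p ∈ itinUpTo (-(c + 1)) w N, gap (w 0) p ≤ B := by
  rcases Fin.two_cases (w 0) with h0 | h0
  · obtain ⟨m, -, hm⟩ := hr 0
    obtain ⟨B, N, hB⟩ := exists_fst_le hc m hw h0 hm
    refine ⟨B - 1, N, fun p hp => ?_⟩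
    rw [gap_zero h0]
    linarith [hB p hp]
  · have h1 : w 1 = 0 := (Fin.two_cases _).resolve_right fun h1 => hw 0 ⟨h0, h1⟩
    obtain ⟨m, -, hm⟩ := hr.shift 1 0
    obtain ⟨B, N, hB⟩ := exists_fst_le hc m (hw.shift 1) h1 hm
    refine ⟨B, N + 1, fun p hp => ?_⟩
    obtain ⟨m0, n0, hp1⟩ := itinUpTo_succ.1 hp
    have := hB _ hp1
    have r := birat_fst_mul (c := c) n0
    have m0' := (mem_Rw_one h0).1 m0
    rw [gap_one h0]
    by_contra! hlt
    nlinarith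

theorem exists_le_fst {c : ℝ} (hc : 0 < c) {w : ℕ → Fin 2} (hw : Adm w) (hr : RepeatsOften w)
    (h0 : w 0 = 0) : ∃ b > 1, ∃ N, ∀ p ∈ itinUpTo (-(c + 1)) w N, b ≤ p.1 := by
  rcases Fin.two_cases (w 1) with h1 | h1
  · obtain ⟨m, -, hm⟩ := hr.shift 1 0
    obtain ⟨B, N, hB⟩ := exists_fst_le hc m (hw.shift 1) h1 hm
    have hB0 : 0 < max B 0 + 1 := by positivity
    refine ⟨1 + c / (max B 0 + 1), by linarith [div_pos hc hB0], N + 1, fun p hp => ?_⟩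
    obtain ⟨m0, n0, hp1⟩ := itinUpTo_succ.1 hp
    have hX := (hB _ hp1).trans (le_max_left B 0)
    have r := birat_fst_mul (c := c) n0
    have m0' := (mem_Rw_zero h0).1 m0
    have m1 := (mem_Rw_zero h1).1 (hp1 0 (Nat.zero_le _)).2
    rw [Function.iterate_zero_apply, birat_snd] at m1
    have : c / (max B 0 + 1) ≤ p.1 - 1 := by
      rw [div_le_iff₀ hB0]
      nlinarith
    linarith
  · refine ⟨c + 2, by linarith, 1, fun p hp => ?_⟩
    have := (mem_Rw_one h1).1 ((itinUpTo_succ.1 hp).2.2 0 le_rfl).2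
    rw [Function.iterate_zero_apply, birat_snd] at this
    linarith

/-! ### Limits of finite itineraries -/

theorem isClosed_Rw (i : Fin 2) : IsClosed (Rw i) := by
  rcases Fin.two_cases i with rfl | rfl
  · exact (isClosed_le continuous_const continuous_fst).inter
      (isClosed_le continuous_snd continuous_const)
  · exact (isClosed_le continuous_fst continuous_const).inter
      (isClosed_le continuous_const continuous_snd)

theorem mem_itinUpTo_of_tendsto {c : ℝ} (hc : 0 < c) (N : ℕ) :
    ∀ {w : ℕ → Fin 2}, Adm w → RepeatsOften w → ∀ {p : ℕ → ℝ × ℝ} {q : ℝ × ℝ},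
      Tendsto p atTop (nhds q) → (∀ M, ∀ᶠ j in atTop, p j ∈ itinUpTo (-(c + 1)) w M) →
      q ∈ itinUpTo (-(c + 1)) w N := by
  have hmem : ∀ {w : ℕ → Fin 2} {p : ℕ → ℝ × ℝ} {q : ℝ × ℝ}, Tendsto p atTop (nhds q) →
      (∀ M, ∀ᶠ j in atTop, p j ∈ itinUpTo (-(c + 1)) w M) → q ∈ Rw (w 0) := fun hq h =>
    (isClosed_Rw _).mem_of_tendsto hq ((h 0).mono fun _ hj => (hj 0 le_rfl).2)
  induction N with
  | zero =>
    intro w _ _ p q hq h n hn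
    obtain rfl : n = 0 := by omega
    exact ⟨fun k hk => absurd hk (by omega), hmem hq h⟩
  | succ N ih =>
    intro w hw hr p q hq h
    have hne : q.1 ≠ 1 := by
      rcases Fin.two_cases (w 0) with h0 | h0
      · obtain ⟨b, hb, M, hM⟩ := exists_le_fst hc hw hr h0
        have : b ≤ q.1 := ge_of_tendsto ((continuous_fst.tendsto q).comp hq)
          ((h M).mono fun j hj => hM _ hj)
        linarith
      · have := ((mem_Rw_one h0).1 (hmem hq h)).1
        linarith
    refine itinUpTo_succ.2 ⟨hmem hq h, hne, ih (hw.shift 1) (hr.shift 1)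
      ((continuousAt_birat hne).tendsto.comp hq) fun M => ?_⟩
    exact (h (M + 1)).mono fun j hj => (itinUpTo_succ.1 hj).2.2

theorem itin_nonempty {c : ℝ} (hc : 0 < c) {w : ℕ → Fin 2} (hw : Adm w) (hr : RepeatsOften w) :
    (itin (-(c + 1)) w).Nonempty := by
  choose s hs0 hs using exists_edge_mem_itinUpTo hc hw
  obtain ⟨B, N, hB⟩ := exists_gap_le hc hw hr
  have hsB : ∀ j, s (j + N) ∈ Set.Icc 0 B := fun j => ⟨hs0 _, by
    simpa [gap_edge] using hB _ (itinUpTo_anti (Nat.le_add_left N j) (hs (j + N)))⟩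
  obtain ⟨l, -, φ, hφ, hl⟩ := isCompact_Icc.tendsto_subseq hsB
  refine ⟨edge (w 0) l, mem_itin_iff_forall.2 fun M => mem_itinUpTo_of_tendsto hc M hw hr
    (((continuous_edge (w 0)).tendsto l).comp hl) fun M => ?_⟩
  filter_upwards [eventually_ge_atTop M] with j hj
  exact itinUpTo_anti ((hj.trans (hφ.id_le j)).trans (Nat.le_add_right _ _)) (hs (φ j + N))

theorem stmt13 (a : ℝ) (ha : a < -1) (w : ℕ → Fin 2)
    (hadm : ∀ k : ℕ, ¬(w k = 1 ∧ w (k + 1) = 1)) :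
    (∀ p ∈ {p : ℝ × ℝ | ∀ n : ℕ, orbitDefined a p n ∧ (birat a)^[n] p ∈ Rw (w n)},
      ∀ q ∈ {p : ℝ × ℝ | ∀ n : ℕ, orbitDefined a p n ∧ (birat a)^[n] p ∈ Rw (w n)},
        (p.1 - q.1) * (p.2 - q.2) ≤ 0) ∧
    interior {p : ℝ × ℝ | ∀ n : ℕ, orbitDefined a p n ∧ (birat a)^[n] p ∈ Rw (w n)} = ∅ ∧
    ((∀ K : ℕ, ∃ n : ℕ, K ≤ n ∧ w n = w (n + 1)) →
      Set.Nonempty {p : ℝ × ℝ | ∀ n : ℕ, orbitDefined a p n ∧ (birat a)^[n] p ∈ Rw (w n)}) := by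
  obtain ⟨c, hc, rfl⟩ : ∃ c : ℝ, 0 < c ∧ a = -(c + 1) := ⟨-(a + 1), by linarith, by ring⟩
  have h : ∀ p ∈ itin (-(c + 1)) w, ∀ q ∈ itin (-(c + 1)) w, (p.1 - q.1) * (p.2 - q.2) ≤ 0 :=
    fun p hp q hq => itin_antitone hc hadm hp hq
  exact ⟨h, interior_eq_empty_of_antitone h, fun hr => itin_nonempty hc hadm hr⟩
end

section
/- (Topological expansivity on the nonwandering set.) There exists η > 0 with the following property: whenever p, q : ℤ → ℝ² are bi-infinite f-orbits with p(n) ∈ R₀ ∪ R₁ and q(n) ∈ R₀ ∪ R₁ for all n ∈ ℤ, and p(0) ≠ q(0), there exists n ∈ ℤ such that the Euclidean distance ‖p(n) − q(n)‖ exceeds η. -/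
open Filter

/-- The first coordinates of a bi-infinite orbit in the (interior of the) two regions,
with `A = -a`. -/
def IsOrb (A : ℝ) (x : ℤ → ℝ) : Prop :=
  ∀ n, x (n + 1) * (x n - 1) = (x (n - 1) - A - 1) * (x n - A) ∧
    ((1 < x n ∧ x (n - 1) < A) ∨ (x n < 0 ∧ A + 1 < x (n - 1)))

/-- The leading cone coordinate of the state `(x (n - 1), x n)`. -/
noncomputable def leadCoord (A : ℝ) (x : ℤ → ℝ) (n : ℤ) : ℝ :=
  if 1 < x n then x n - 1 else x (n - 1) - A

/-- The transverse cone coordinate of the state `(x (n - 1), x n)`. -/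
noncomputable def transCoord (A : ℝ) (x : ℤ → ℝ) (n : ℤ) : ℝ :=
  if 1 < x n then A - x (n - 1) else 1 - x n

/-- The unstable cone relation between two states. -/
def Cone (A : ℝ) (x y : ℤ → ℝ) (n : ℤ) : Prop :=
  leadCoord A y n < leadCoord A x n ∧
    transCoord A x n * leadCoord A y n ≤ transCoord A y n * leadCoord A x n

/-- The expanding quantity for two orbits `x`, `y`, weighted along the orbit `w`. -/
noncomputable def coneSize (A : ℝ) (x y w : ℤ → ℝ) (n : ℤ) : ℝ :=
  (leadCoord A x n - leadCoord A y n) ^ 2 * (transCoord A w n / leadCoord A w n)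

theorem slope_lt {z₁ t₁ z₂ t₂ : ℝ} (ht₁ : 0 < t₁) (ht₂ : 0 < t₂)
    (ht : t₂ < t₁) (hz : z₁ * t₂ ≤ z₂ * t₁) : (z₁ + 1) / t₁ < (z₂ + 1) / t₂ := by
  rw [div_lt_div_iff₀ ht₁ ht₂]
  linarith

theorem mid_cone {B k₁ s₁ t₁ u₁ k₂ s₂ t₂ u₂ : ℝ} (hk₁ : 0 < k₁)
    (hs₁ : 0 < s₁) (hs₂ : 0 < s₂) (h₁ : s₁ + t₁ = B) (h₂ : s₂ + t₂ = B)
    (e₁ : u₁ + 1 = k₁ * s₁) (e₂ : u₂ + 1 = k₂ * s₂) (ht : t₂ < t₁) (hk : k₁ < k₂) :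
    u₁ < u₂ ∧ s₂ * u₁ ≤ s₁ * u₂ ∧ (t₁ - t₂) * k₁ ≤ u₂ - u₁ ∧ (t₁ - t₂) * k₂ ≤ u₂ - u₁ := by
  obtain rfl : u₁ = k₁ * s₁ - 1 := by linarith
  obtain rfl : u₂ = k₂ * s₂ - 1 := by linarith
  obtain rfl : t₁ = B - s₁ := by linarith
  obtain rfl : t₂ = B - s₂ := by linarith
  have h12 := mul_pos (mul_pos hs₁ hs₂) (sub_pos.2 hk)
  have p1 := mul_pos hs₁ (sub_pos.2 hk)
  have p2 := mul_pos hs₂ (sub_pos.2 hk)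
  have p3 : 0 < k₁ * (s₂ - s₁) := mul_pos hk₁ (by linarith)
  refine ⟨?_, ?_, ?_, ?_⟩ <;> nlinarith

theorem mid_growth {e e' z t k s u : ℝ} (he : 0 < e) (hz : 0 < z) (ht : 0 < t) (hs : 0 < s)
    (hu : 0 < u) (hk : k = (z + 1) / t) (hu' : u + 1 = k * s) (hee : e * k ≤ e') :
    e ^ 2 * (z / t) * (1 + 1 / u) ≤ e' ^ 2 * (s / u) ∧ e ^ 2 * (z / t) ≤ e * e' := by
  have hkp : 0 < k := hk ▸ by positivity
  have hzk : z / t ≤ k := by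
    rw [hk]; gcongr; linarith
  constructor
  · calc e ^ 2 * (z / t) * (1 + 1 / u) ≤ e ^ 2 * k * (1 + 1 / u) := by gcongr
      _ = (e * k) ^ 2 * (s / u) := by
        have : s = (u + 1) / k := by rw [hu']; field_simp
        rw [this]; field_simp
      _ ≤ e' ^ 2 * (s / u) := by gcongr
  · calc e ^ 2 * (z / t) ≤ e ^ 2 * k := by gcongr
      _ = e * (e * k) := by ring
      _ ≤ e * e' := by gcongr

theorem high_cone {B k₁ t₁ τ₁ k₂ t₂ τ₂ : ℝ} (hB₁ : B < t₁) (hB₂ : B < t₂)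
    (e₁ : τ₁ = k₁ * (t₁ - B) + 1) (e₂ : τ₂ = k₂ * (t₂ - B) + 1) (ht : t₂ < t₁) (hk : k₁ < k₂) :
    τ₁ * (t₂ - B) ≤ τ₂ * (t₁ - B) := by
  subst e₁ e₂
  have := mul_pos (mul_pos (sub_pos.2 hB₁) (sub_pos.2 hB₂)) (sub_pos.2 hk)
  nlinarith

theorem high_growth {B z t τ : ℝ} (ht : 0 < t) (hB : B < t)
    (h : τ = (z + 1) / t * (t - B) + 1) : z / t ≤ τ / (t - B) := by
  have hr : 0 < t - B := sub_pos.2 hB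
  have h1 : τ / (t - B) = (z + 1) / t + 1 / (t - B) := by
    rw [h]; field_simp
  have h2 : z / t ≤ (z + 1) / t := by gcongr; linarith
  have : 0 < 1 / (t - B) := by positivity
  linarith

theorem low_cone {B r₁ τ₁ u₁ r₂ τ₂ u₂ : ℝ} (hB : 0 < B) (hr₂ : 1 < r₂)
    (hτ₁ : 0 < τ₁) (hτ₂ : 0 < τ₂) (hu₁ : 0 < u₁)
    (e₁ : u₁ + 1 = (r₁ - 1) / τ₁ * (τ₁ + B)) (e₂ : u₂ + 1 = (r₂ - 1) / τ₂ * (τ₂ + B))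
    (hr : r₂ < r₁) (h : τ₁ * r₂ ≤ τ₂ * r₁) :
    r₁ - r₂ ≤ u₁ - u₂ ∧ (τ₁ + B) * u₂ ≤ (τ₂ + B) * u₁ := by
  have hm : (r₂ - 1) / τ₂ ≤ (r₁ - 1) / τ₁ := by
    rw [div_le_div_iff₀ hτ₂ hτ₁]
    rcases le_total τ₁ τ₂ with h' | h'
    · nlinarith
    · nlinarith
  have f₁ : u₁ + 1 = r₁ - 1 + B * ((r₁ - 1) / τ₁) := by rw [e₁]; field_simp
  have f₂ : u₂ + 1 = r₂ - 1 + B * ((r₂ - 1) / τ₂) := by rw [e₂]; field_simp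
  have hBm := mul_le_mul_of_nonneg_left hm hB.le
  have hu : r₁ - r₂ ≤ u₁ - u₂ := by linarith
  refine ⟨hu, ?_⟩
  rcases le_total τ₁ τ₂ with h' | h'
  · nlinarith
  · have := mul_le_mul_of_nonneg_left hm (by positivity : 0 ≤ (τ₁ + B) * (τ₂ + B))
    obtain h₁ : u₁ = (r₁ - 1) / τ₁ * (τ₁ + B) - 1 := by linarith
    obtain h₂ : u₂ = (r₂ - 1) / τ₂ * (τ₂ + B) - 1 := by linarith
    rw [h₁, h₂]
    nlinarith

theorem low_growth {B r τ u : ℝ} (hB : 0 < B) (hr : 1 < r) (hτ : 0 < τ) (hu : 0 < u)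
    (h : u + 1 = (r - 1) / τ * (τ + B)) :
    τ / r ≤ (τ + B) / u ∧ (u < B → (1 + 1 / (B + 1)) * (τ / r) ≤ (τ + B) / u) := by
  have hr' : 0 < r - 1 := sub_pos.2 hr
  have h1 : τ / (r - 1) ≤ (τ + B) / u := by
    rw [div_le_div_iff₀ hr' hu]
    have : (u + 1) * τ = (r - 1) * (τ + B) := by rw [h]; field_simp
    nlinarith
  have h2 : τ / r ≤ τ / (r - 1) := by gcongr; linarith
  refine ⟨h2.trans h1, fun huB => le_trans ?_ h1⟩
  have h3 : r - 1 ≤ B + 1 := by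
    have : u + 1 = r - 1 + B * ((r - 1) / τ) := by rw [h]; field_simp
    have : 0 < B * ((r - 1) / τ) := by positivity
    linarith
  calc (1 + 1 / (B + 1)) * (τ / r) ≤ (1 + 1 / (r - 1)) * (τ / r) := by gcongr
    _ = τ / (r - 1) := by field_simp; ring

theorem leadCoord_pos {A : ℝ} {x : ℤ → ℝ} (hx : IsOrb A x) (n : ℤ) :
    0 < leadCoord A x n := by
  unfold leadCoord
  split_ifs with h
  · linarith
  · rcases (hx n).2 with h' | h' <;> linarith

theorem transCoord_pos {A : ℝ} {x : ℤ → ℝ} (hx : IsOrb A x) (n : ℤ) :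
    0 < transCoord A x n := by
  unfold transCoord
  split_ifs with h <;> rcases (hx n).2 with h' | h' <;> linarith

theorem IsOrb.cases {A : ℝ} {x : ℤ → ℝ} (hA : 1 < A) (hx : IsOrb A x) (n : ℤ) :
    (1 < x n ∧ x n < A ∧ 1 < x (n + 1)) ∨ (A + 1 < x n ∧ x (n + 1) < 0) ∨
      (x n < 0 ∧ 1 < x (n + 1)) := by
  have h1 := (hx n).2
  have h2 := (hx (n + 1)).2
  rw [add_sub_cancel_right] at h2
  rcases h1 with h1 | h1 <;> rcases h2 with h2 | h2
  · exact Or.inl ⟨h1.1, h2.2, h2.1⟩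
  · exact Or.inr (Or.inl ⟨h2.2, h2.1⟩)
  · exact Or.inr (Or.inr ⟨h1.1, h2.1⟩)
  · linarith [h1.1, h2.2]

/-- Passage through the middle strip `1 < x n < A`. -/
theorem IsOrb.mid_step {A : ℝ} {x : ℤ → ℝ} (hx : IsOrb A x) {n : ℤ} (h1 : 1 < x n)
    (h3 : 1 < x (n + 1)) :
    transCoord A x (n + 1) + leadCoord A x n = A - 1 ∧
      leadCoord A x (n + 1) + 1 =
        (transCoord A x n + 1) / leadCoord A x n * transCoord A x (n + 1) := by
  simp only [leadCoord, transCoord, if_pos h1, if_pos h3, add_sub_cancel_right]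
  refine ⟨by ring, ?_⟩
  have := (hx n).1
  have : x n - 1 ≠ 0 := by linarith
  field_simp
  linarith

/-- Passage through the half plane `A + 1 < x n`. -/
theorem IsOrb.high_step {A : ℝ} {x : ℤ → ℝ} (hx : IsOrb A x) {n : ℤ} (h1 : 1 < x n)
    (h3 : x (n + 1) < 0) :
    leadCoord A x (n + 1) = leadCoord A x n - (A - 1) ∧
      transCoord A x (n + 1) =
        (transCoord A x n + 1) / leadCoord A x n * (leadCoord A x n - (A - 1)) + 1 := by
  have h4 : ¬ 1 < x (n + 1) := by linarith
  simp only [leadCoord, transCoord, if_pos h1, if_neg h4, add_sub_cancel_right]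
  refine ⟨by ring, ?_⟩
  have := (hx n).1
  have : x n - 1 ≠ 0 := by linarith
  field_simp
  linarith

/-- Passage through the half plane `x n < 0`. -/
theorem IsOrb.low_step {A : ℝ} {x : ℤ → ℝ} (hx : IsOrb A x) {n : ℤ} (h1 : x n < 0)
    (h3 : 1 < x (n + 1)) :
    transCoord A x (n + 1) = transCoord A x n + (A - 1) ∧
      leadCoord A x (n + 1) + 1 =
        (leadCoord A x n - 1) / transCoord A x n * (transCoord A x n + (A - 1)) := by
  have h4 : ¬ 1 < x n := by linarith
  simp only [leadCoord, transCoord, if_pos h3, if_neg h4, add_sub_cancel_right]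
  refine ⟨by ring, ?_⟩
  have := (hx n).1
  have : 1 - x n ≠ 0 := by linarith
  field_simp
  linarith

/-- One step of growth of `coneSize`. -/
def Grows (A : ℝ) (x y w : ℤ → ℝ) (n : ℤ) : Prop :=
  coneSize A x y w n ≤ coneSize A x y w (n + 1) ∧
  (1 < w (n + 1) → w (n + 1) < A →
    (1 + 1 / A) * coneSize A x y w n ≤ coneSize A x y w (n + 1)) ∧
  (1 < w n → w n < A → coneSize A x y w n ≤
    |leadCoord A x n - leadCoord A y n| * |leadCoord A x (n + 1) - leadCoord A y (n + 1)|)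

theorem Grows.symm {A : ℝ} {x y w : ℤ → ℝ} {n : ℤ} (h : Grows A x y w n) : Grows A y x w n := by
  have hc : ∀ m, coneSize A y x w m = coneSize A x y w m := fun m => by
    unfold coneSize; ring
  unfold Grows at *
  simpa only [hc, abs_sub_comm (leadCoord A y _)] using h

theorem coneSize_pos {A : ℝ} {x y w : ℤ → ℝ} (hw : IsOrb A w) {n : ℤ}
    (h : leadCoord A y n ≠ leadCoord A x n) : 0 < coneSize A x y w n := by
  have := leadCoord_pos hw n
  have := transCoord_pos hw n
  have := sq_pos_of_ne_zero (sub_ne_zero.2 h.symm)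
  unfold coneSize
  positivity

theorem grows_mid {A : ℝ} {x y w : ℤ → ℝ} (hw : IsOrb A w) {n : ℤ}
    (h1 : 1 < w n) (h3 : 1 < w (n + 1)) (he : leadCoord A y n < leadCoord A x n)
    (hee : (leadCoord A x n - leadCoord A y n) * ((transCoord A w n + 1) / leadCoord A w n) ≤
      leadCoord A y (n + 1) - leadCoord A x (n + 1)) : Grows A x y w n := by
  have ht := leadCoord_pos hw n
  have hz := transCoord_pos hw n
  have hu := leadCoord_pos hw (n + 1)
  have hs := transCoord_pos hw (n + 1)
  obtain ⟨hst, hstep⟩ := hw.mid_step h1 h3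
  obtain ⟨g1, g2⟩ := mid_growth (sub_pos.2 he) hz ht hs hu rfl hstep hee
  have hN := coneSize_pos (x := x) (y := y) hw he.ne
  have hsq : (leadCoord A y (n + 1) - leadCoord A x (n + 1)) ^ 2 *
      (transCoord A w (n + 1) / leadCoord A w (n + 1)) = coneSize A x y w (n + 1) := by
    unfold coneSize; ring
  rw [hsq] at g1
  change coneSize A x y w n * _ ≤ _ at g1
  have hu' : 0 < 1 / leadCoord A w (n + 1) := by positivity
  refine ⟨by nlinarith, fun _ h5 => ?_, fun _ _ => ?_⟩
  · have : 1 / A ≤ 1 / leadCoord A w (n + 1) := by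
      apply one_div_le_one_div_of_le hu
      simp only [leadCoord, if_pos h3]
      linarith
    nlinarith
  · have hk : 0 < (transCoord A w n + 1) / leadCoord A w n := by positivity
    have h5 : 0 < leadCoord A y (n + 1) - leadCoord A x (n + 1) :=
      lt_of_lt_of_le (mul_pos (sub_pos.2 he) hk) hee
    rw [abs_of_pos (sub_pos.2 he), abs_sub_comm, abs_of_pos h5]
    exact g2

theorem grows_high {A : ℝ} {x y w : ℤ → ℝ} (hw : IsOrb A w) {n : ℤ}
    (h1 : A + 1 < w n) (h3 : w (n + 1) < 0) (hA : 1 < A)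
    (hee : leadCoord A x (n + 1) - leadCoord A y (n + 1) = leadCoord A x n - leadCoord A y n) :
    Grows A x y w n := by
  have h1' : 1 < w n := by linarith
  obtain ⟨e1, e2⟩ := hw.high_step h1' h3
  have hB : A - 1 < leadCoord A w n := by
    simp only [leadCoord, if_pos h1']; linarith
  have := high_growth (leadCoord_pos hw n) hB e2
  refine ⟨?_, fun h _ => by linarith, fun _ h => by linarith⟩
  unfold coneSize
  rw [hee, e1]
  gcongr

theorem grows_low {A : ℝ} {x y w : ℤ → ℝ} (hw : IsOrb A w) {n : ℤ}
    (h1 : w n < 0) (h3 : 1 < w (n + 1)) (hA : 1 < A) (he : leadCoord A y n < leadCoord A x n)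
    (hee : leadCoord A x n - leadCoord A y n ≤ leadCoord A x (n + 1) - leadCoord A y (n + 1)) :
    Grows A x y w n := by
  obtain ⟨e1, e2⟩ := hw.low_step h1 h3
  have hr : 1 < leadCoord A w n := by
    have : ¬ 1 < w n := by linarith
    simp only [leadCoord, if_neg this]
    rcases (hw n).2 with h | h <;> linarith
  have hz := transCoord_pos hw n
  have hz' := transCoord_pos hw (n + 1)
  have hu := leadCoord_pos hw (n + 1)
  obtain ⟨g1, g2⟩ := low_growth (sub_pos.2 hA) hr hz hu e2
  have he' := sub_pos.2 he
  unfold Grows coneSize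
  rw [e1] at hz' ⊢
  refine ⟨by gcongr, fun _ h => ?_, fun h _ => by linarith⟩
  have hlt : leadCoord A w (n + 1) < A - 1 := by
    simp only [leadCoord, if_pos h3]; linarith
  have g := g2 hlt
  rw [sub_add_cancel] at g
  rw [mul_left_comm]
  gcongr

theorem cone_step {A : ℝ} (hA : 1 < A) {x y : ℤ → ℝ} (hx : IsOrb A x) (hy : IsOrb A y)
    (hxy : ∀ n, |x n - y n| ≤ 1 / 2) {n : ℤ} (hc : Cone A x y n) :
    (Cone A x y (n + 1) ∨ Cone A y x (n + 1)) ∧ Grows A x y x n ∧ Grows A x y y n := by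
  obtain ⟨he, hz⟩ := hc
  have c0 := abs_le.1 (hxy n)
  have hk := slope_lt (leadCoord_pos hx n) (leadCoord_pos hy n) he hz
  have tx := leadCoord_pos hx n
  have ty := leadCoord_pos hy n
  have zx := transCoord_pos hx n
  have zy := transCoord_pos hy n
  have sx := transCoord_pos hx (n + 1)
  have sy := transCoord_pos hy (n + 1)
  have ux := leadCoord_pos hx (n + 1)
  rcases hx.cases hA n with h | h | h <;> rcases hy.cases hA n with h' | h' | h'
  · obtain ⟨a1, a2⟩ := hx.mid_step h.1 h.2.2
    obtain ⟨b1, b2⟩ := hy.mid_step h'.1 h'.2.2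
    obtain ⟨m1, m2, m3, m4⟩ := mid_cone (by positivity) sx sy a1 b1 a2 b2 he hk
    exact ⟨Or.inr ⟨m1, m2⟩, grows_mid hx h.1 h.2.2 he m3, grows_mid hy h'.1 h'.2.2 he m4⟩
  · linarith
  · linarith
  · linarith
  · have h1 : 1 < x n := by linarith
    have h2 : 1 < y n := by linarith
    obtain ⟨a1, a2⟩ := hx.high_step h1 h.2
    obtain ⟨b1, b2⟩ := hy.high_step h2 h'.2
    have Bx : A - 1 < leadCoord A x n := by
      simp only [leadCoord, if_pos h1]; linarith
    have By : A - 1 < leadCoord A y n := by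
      simp only [leadCoord, if_pos h2]; linarith
    have hee : leadCoord A x (n + 1) - leadCoord A y (n + 1) =
      leadCoord A x n - leadCoord A y n := by rw [a1, b1]; ring
    refine ⟨Or.inl ⟨by linarith, ?_⟩, grows_high hx h.1 h.2 hA hee,
      grows_high hy h'.1 h'.2 hA hee⟩
    have := high_cone Bx By a2 b2 he hk
    rwa [← a1, ← b1] at this
  · linarith
  · linarith
  · linarith
  · obtain ⟨a1, a2⟩ := hx.low_step h.1 h.2
    obtain ⟨b1, b2⟩ := hy.low_step h'.1 h'.2
    have hr : 1 < leadCoord A y n := by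
      have : ¬ 1 < y n := by linarith
      simp only [leadCoord, if_neg this]
      rcases (hy n).2 with h | h <;> linarith
    obtain ⟨m1, m2⟩ := low_cone (sub_pos.2 hA) hr zx zy ux a2 b2 he hz
    rw [← a1, ← b1] at m2
    exact ⟨Or.inl ⟨by linarith, m2⟩, grows_low hx h.1 h.2 hA he m1,
      grows_low hy h'.1 h'.2 hA he m1⟩

/-- An orbit cannot alternate forever between the two half planes. -/
theorem IsOrb.exists_mid {A : ℝ} (hA : 1 < A) {x : ℤ → ℝ} (hx : IsOrb A x) (m : ℤ) :
    ∃ n, m ≤ n ∧ 1 < x n ∧ x n < A := by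
  by_contra! hno
  have hstep : ∀ n, m ≤ n → A + 1 < x n → A + 1 < x (n + 1 + 1) ∧
      transCoord A x (n + 1 + 1) ≤ transCoord A x n + (A + 1) ∧
      leadCoord A x (n + 1 + 1) / transCoord A x (n + 1 + 1) ≤
        leadCoord A x n / transCoord A x n - 1 / transCoord A x (n + 1 + 1) := by
    intro n hn hxn
    have h0 : x (n + 1) < 0 := by
      rcases hx.cases hA n with h | h | h <;> linarith [h.1, h.2]
    have h2 : 1 < x (n + 1 + 1) := by
      rcases hx.cases hA (n + 1) with h | h | h <;> linarith [h.1, h.2]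
    have h2' : A + 1 < x (n + 1 + 1) := by
      rcases hx.cases hA (n + 1 + 1) with h | h | h
      · linarith [hno (n + 1 + 1) (by linarith) h2]
      · exact h.1
      · linarith
    obtain ⟨a1, a2⟩ := hx.high_step (by linarith) h0
    obtain ⟨b1, b2⟩ := hx.low_step h0 h2
    have t0 := leadCoord_pos hx n
    have z0 := transCoord_pos hx n
    have r0 := leadCoord_pos hx (n + 1)
    have q0 := transCoord_pos hx (n + 1)
    have z2 := transCoord_pos hx (n + 1 + 1)
    set t := leadCoord A x n
    set z := transCoord A x n
    set r := leadCoord A x (n + 1)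
    set τ := transCoord A x (n + 1)
    have hτ : τ ≤ z + 2 := by
      have : (z + 1) / t * (t - (A - 1)) ≤ z + 1 := by
        rw [div_mul_eq_mul_div, div_le_iff₀ t0]; nlinarith
      linarith
    refine ⟨h2', by linarith, ?_⟩
    rw [← b1] at b2
    have e : leadCoord A x (n + 1 + 1) / transCoord A x (n + 1 + 1) =
        (r - 1) / τ - 1 / transCoord A x (n + 1 + 1) := by
      rw [eq_sub_iff_add_eq, ← add_div, b2]; field_simp
    rw [e]
    have : (r - 1) / τ ≤ t / z := by
      rw [← a1] at a2
      have : τ * t = (z + 1) * r + t := by rw [a2]; field_simp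
      rw [div_le_div_iff₀ q0 z0]
      nlinarith
    linarith
  obtain ⟨n₀, hn₀, hx₀⟩ : ∃ n, m ≤ n ∧ A + 1 < x n := by
    rcases hx.cases hA m with h | h | h
    · linarith [hno m le_rfl h.1]
    · exact ⟨m, le_rfl, h.1⟩
    · refine ⟨m + 1, by linarith, ?_⟩
      rcases hx.cases hA (m + 1) with h' | h' | h'
      · linarith [hno (m + 1) (by linarith) h.2]
      · exact h'.1
      · linarith
  set C := transCoord A x n₀ + (A + 1)
  have z0 := transCoord_pos hx n₀
  have hC : 0 < C := by positivity
  have key : ∀ k : ℕ, A + 1 < x (n₀ + 2 * k) ∧ transCoord A x (n₀ + 2 * k) ≤ C * (k + 1) ∧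
      leadCoord A x (n₀ + 2 * k) / transCoord A x (n₀ + 2 * k) ≤
        leadCoord A x n₀ / transCoord A x n₀ + 1 / C -
          1 / C * ∑ j ∈ Finset.range (k + 1), 1 / ((j : ℝ) + 1) := by
    intro k
    induction k with
    | zero =>
      simp only [Nat.cast_zero, mul_zero, add_zero, zero_add, Finset.sum_range_one]
      refine ⟨hx₀, ?_, by simp⟩
      simp only [C]; linarith
    | succ k ih =>
      obtain ⟨i1, i2, i3⟩ := ih
      obtain ⟨s1, s2, s3⟩ := hstep (n₀ + 2 * k) (by linarith [Int.natCast_nonneg k]) i1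
      have hn : n₀ + 2 * (k : ℤ) + 1 + 1 = n₀ + 2 * ((k + 1 : ℕ) : ℤ) := by push_cast; ring
      rw [hn] at s1 s2 s3
      have hle : transCoord A x (n₀ + 2 * ((k + 1 : ℕ) : ℤ)) ≤ C * (((k + 1 : ℕ) : ℝ) + 1) := by
        have : A + 1 ≤ C := by simp only [C]; linarith
        push_cast at s2 ⊢
        linarith
      refine ⟨s1, hle, ?_⟩
      rw [Finset.sum_range_succ, mul_add]
      have : 1 / C * (1 / (((k + 1 : ℕ) : ℝ) + 1)) ≤
          1 / transCoord A x (n₀ + 2 * ((k + 1 : ℕ) : ℤ)) := by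
        rw [one_div_mul_one_div]
        exact one_div_le_one_div_of_le (transCoord_pos hx _) hle
      linarith
  have hlim := Real.tendsto_sum_range_one_div_nat_succ_atTop.comp (tendsto_add_atTop_nat 1)
  obtain ⟨k, hk⟩ := (hlim.eventually_gt_atTop
    (C * (leadCoord A x n₀ / transCoord A x n₀ + 1 / C))).exists
  have hk' := (key k).2.2
  have hpos : 0 < leadCoord A x (n₀ + 2 * k) / transCoord A x (n₀ + 2 * k) :=
    div_pos (leadCoord_pos hx _) (transCoord_pos hx _)
  simp only [Function.comp] at hk
  have := mul_lt_mul_of_pos_left hk (one_div_pos.2 hC)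
  rw [← mul_assoc, one_div_mul_cancel hC.ne', one_mul] at this
  linarith

theorem IsOrb.dist_contra {A : ℝ} (hA : 1 < A) {x y : ℤ → ℝ} (hx : IsOrb A x) (hy : IsOrb A y)
    (hxy : ∀ n, |x n - y n| ≤ 1 / 2) {m : ℤ} (hc : Cone A x y m) : False := by
  have hcone : ∀ n, m ≤ n → Cone A x y n ∨ Cone A y x n := by
    intro n hn
    induction n, hn using Int.leInduction with
    | base => exact Or.inl hc
    | succ n _ ih =>
      rcases ih with h | h
      · exact (cone_step hA hx hy hxy h).1
      · exact (cone_step hA hy hx (fun n => abs_sub_comm (x n) (y n) ▸ hxy n) h).1.symm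
  have hgrow : ∀ n, m ≤ n → Grows A x y x n := by
    intro n hn
    rcases hcone n hn with h | h
    · exact (cone_step hA hx hy hxy h).2.1
    · exact (cone_step hA hy hx (fun n => abs_sub_comm (x n) (y n) ▸ hxy n) h).2.2.symm
  have hmono : ∀ n, m ≤ n → ∀ k, n ≤ k → coneSize A x y x n ≤ coneSize A x y x k := by
    intro n hn k hk
    induction k, hk using Int.leInduction with
    | base => exact le_rfl
    | succ k hk ih => exact ih.trans (hgrow k (hn.trans hk)).1
  set q := 1 + 1 / A
  have hq : 1 < q := by
    have : 0 < 1 / A := by positivity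
    simp only [q]; linarith
  have hN := coneSize_pos (x := x) (y := y) hx hc.1.ne
  have hpow : ∀ k : ℕ, ∃ n, m ≤ n ∧ q ^ k * coneSize A x y x m ≤ coneSize A x y x n := by
    intro k
    induction k with
    | zero => exact ⟨m, le_rfl, by simp⟩
    | succ k ih =>
      obtain ⟨n, hn, h⟩ := ih
      obtain ⟨l, hl, h1, h2⟩ := hx.exists_mid hA (n + 1)
      have hg := (hgrow (l - 1) (by linarith)).2.1
      rw [sub_add_cancel] at hg
      refine ⟨l, by linarith, le_trans ?_ (hg h1 h2)⟩
      rw [pow_succ', mul_assoc]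
      have := h.trans (hmono n hn (l - 1) (by linarith))
      gcongr
  obtain ⟨k, hk⟩ := pow_unbounded_of_one_lt (1 / coneSize A x y x m) hq
  rw [div_lt_iff₀ hN] at hk
  obtain ⟨n, hn, h⟩ := hpow k
  obtain ⟨l, hl, h1, h2⟩ := hx.exists_mid hA n
  have hb := (hgrow l (hn.trans hl)).2.2 h1 h2
  have h3 : 1 < x (l + 1) := by
    rcases hx.cases hA l with h | h | h <;> linarith [h.1, h.2]
  have hlead : ∀ j, 1 < x j → |leadCoord A x j - leadCoord A y j| ≤ 1 / 2 := by
    intro j hj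
    have hj' : 1 < y j := by
      have := abs_le.1 (hxy j)
      rcases (hy j).2 with h | h
      · exact h.1
      · linarith [h.1]
    simp only [leadCoord, if_pos hj, if_pos hj', sub_sub_sub_cancel_right]
    exact hxy j
  have := mul_le_mul (hlead l h1) (hlead (l + 1) h3) (abs_nonneg _) (by norm_num)
  have := hmono n hn l hl
  linarith

/-- Time reversal of orbits. -/
def timeReverse (A : ℝ) (x : ℤ → ℝ) (n : ℤ) : ℝ := A + 1 - x (-n)

theorem IsOrb.rev {A : ℝ} {x : ℤ → ℝ} (hx : IsOrb A x) : IsOrb A (timeReverse A x) := by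
  intro n
  have h1 := (hx (-n)).1
  have h2 := (hx (-n + 1)).2
  rw [add_sub_cancel_right] at h2
  have e1 : -(n + 1) = -n - 1 := by ring
  have e2 : -(n - 1) = -n + 1 := by ring
  simp only [timeReverse, e1, e2]
  refine ⟨by linarith, ?_⟩
  rcases h2 with h | h
  · exact Or.inl ⟨by linarith, by linarith⟩
  · exact Or.inr ⟨by linarith, by linarith⟩

theorem IsOrb.rev_coord {A : ℝ} {x : ℤ → ℝ} (hx : IsOrb A x) (n : ℤ) :
    leadCoord A (timeReverse A x) (1 - n) = transCoord A x n ∧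
      transCoord A (timeReverse A x) (1 - n) = leadCoord A x n := by
  have e1 : -(1 - n) = n - 1 := by ring
  have e2 : -(1 - n - 1) = n := by ring
  simp only [leadCoord, transCoord, timeReverse, e1, e2]
  rcases (hx n).2 with h | h
  · have : 1 < A + 1 - x (n - 1) := by linarith
    rw [if_pos h.1, if_pos h.1, if_pos this, if_pos this]
    constructor <;> ring
  · have : ¬ 1 < A + 1 - x (n - 1) := by linarith
    have h' : ¬ 1 < x n := by linarith
    rw [if_neg h', if_neg h', if_neg this, if_neg this]
    constructor <;> ring

theorem cone_or_cone_swap {z₁ t₁ z₂ t₂ : ℝ} (hz₁ : 0 < z₁) (ht₁ : 0 < t₁) (hz₂ : 0 < z₂)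
    (ht₂ : 0 < t₂) (h : z₁ ≠ z₂ ∨ t₁ ≠ t₂) :
    (t₂ < t₁ ∧ z₁ * t₂ ≤ z₂ * t₁) ∨ (t₁ < t₂ ∧ z₂ * t₁ ≤ z₁ * t₂) ∨
      (z₂ < z₁ ∧ t₁ * z₂ ≤ t₂ * z₁) ∨ (z₁ < z₂ ∧ t₂ * z₁ ≤ t₁ * z₂) := by
  rcases lt_trichotomy t₁ t₂ with ht | ht | ht <;> rcases lt_trichotomy z₁ z₂ with hz | hz | hz <;>
    rcases le_total (z₁ * t₂) (z₂ * t₁) with hl | hl <;> simp_all [mul_comm] <;> nlinarith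

theorem IsOrb.eq_of_close {A : ℝ} (hA : 1 < A) {x y : ℤ → ℝ} (hx : IsOrb A x) (hy : IsOrb A y)
    (hxy : ∀ n, |x n - y n| ≤ 1 / 2) (n : ℤ) : x (n - 1) = y (n - 1) ∧ x n = y n := by
  have hyx : ∀ n, |y n - x n| ≤ 1 / 2 := fun n => abs_sub_comm (x n) (y n) ▸ hxy n
  have hrev : ∀ n, |timeReverse A x n - timeReverse A y n| ≤ 1 / 2 := fun n => by
    simpa only [timeReverse, sub_sub_sub_cancel_left] using hyx (-n)
  have hrev' : ∀ n, |timeReverse A y n - timeReverse A x n| ≤ 1 / 2 := fun n => by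
    simpa only [timeReverse, sub_sub_sub_cancel_left] using hxy (-n)
  by_cases h : transCoord A x n ≠ transCoord A y n ∨ leadCoord A x n ≠ leadCoord A y n
  · exfalso
    obtain ⟨a1, a2⟩ := hx.rev_coord n
    obtain ⟨b1, b2⟩ := hy.rev_coord n
    rcases cone_or_cone_swap (transCoord_pos hx n) (leadCoord_pos hx n)
      (transCoord_pos hy n) (leadCoord_pos hy n) h with h | h | h | h
    · exact hx.dist_contra hA hy hxy h
    · exact hy.dist_contra hA hx hyx h
    · rw [← a1, ← a2, ← b1, ← b2] at h
      exact hx.rev.dist_contra hA hy.rev hrev h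
    · rw [← a1, ← a2, ← b1, ← b2] at h
      exact hy.rev.dist_contra hA hx.rev hrev' h
  · push Not at h
    have c := abs_le.1 (hxy n)
    simp only [leadCoord, transCoord] at h
    rcases (hx n).2 with h1 | h1 <;> rcases (hy n).2 with h2 | h2
    · rw [if_pos h1.1, if_pos h1.1, if_pos h2.1, if_pos h2.1] at h
      exact ⟨by linarith, by linarith⟩
    · linarith
    · linarith
    · have h1' : ¬ 1 < x n := by linarith
      have h2' : ¬ 1 < y n := by linarith
      rw [if_neg h1', if_neg h1', if_neg h2', if_neg h2'] at h
      exact ⟨by linarith, by linarith⟩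

theorem isOrb_of_birat {a : ℝ} (ha : a < -1) {p : ℤ → ℝ × ℝ}
    (hp : ∀ n : ℤ, (p n).1 ≠ 1 ∧ p (n + 1) = birat a (p n))
    (hR : ∀ n : ℤ, p n ∈ Rzero ∪ Rone) :
    (∀ n, (p n).2 = (p (n - 1)).1 + a - 1) ∧ IsOrb (-a) fun n => (p n).1 := by
  have hy : ∀ n, (p n).2 = (p (n - 1)).1 + a - 1 := fun n => by
    have := (hp (n - 1)).2
    rw [sub_add_cancel] at this
    rw [this, birat]
  have hrec : ∀ n, (p (n + 1)).1 * ((p n).1 - 1) =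
      ((p (n - 1)).1 - -a - 1) * ((p n).1 - -a) := fun n => by
    have h1 : (p n).1 - 1 ≠ 0 := sub_ne_zero.2 (hp n).1
    rw [(hp n).2, birat]
    simp only [hy n]
    field_simp
    ring
  have hR' : ∀ n, (1 < (p n).1 ∧ (p (n - 1)).1 ≤ -a) ∨
      ((p n).1 ≤ 0 ∧ -a + 1 ≤ (p (n - 1)).1) := fun n => by
    rcases hR n with ⟨h1, h2⟩ | ⟨h1, h2⟩
    · exact Or.inl ⟨lt_of_le_of_ne h1 (hp n).1.symm, by linarith [hy n]⟩
    · exact Or.inr ⟨h1, by linarith [hy n]⟩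
  refine ⟨hy, fun n => ⟨hrec n, ?_⟩⟩
  have r0 := hrec n
  have r1 := hrec (n - 1)
  have s1 := hR' (n + 1)
  have s2 := hR' (n - 1)
  rw [sub_add_cancel] at r1
  rw [add_sub_cancel_right] at s1
  dsimp only
  rcases hR' n with ⟨h1, h2⟩ | ⟨h1, h2⟩
  · refine Or.inl ⟨h1, lt_of_le_of_ne h2 fun h => ?_⟩
    rw [h] at r1
    have : (p n).1 * (-a - 1) = 0 := by rw [r1]; ring
    nlinarith
  · refine Or.inr ⟨lt_of_le_of_ne h1 fun h => ?_, lt_of_le_of_ne h2 fun h => ?_⟩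
    · rw [h, zero_mul] at r1
      rcases mul_eq_zero.1 r1.symm with h' | h' <;> rcases s2 with s2 | s2 <;>
        linarith [s2.1, s2.2, sub_add_cancel n 1]
    · rw [← h] at r0
      have : (p (n + 1)).1 * ((p n).1 - 1) = 0 := by rw [r0]; ring
      rcases mul_eq_zero.1 this with h' | h' <;> rcases s1 with s1 | s1 <;> linarith [s1.1, s1.2]

theorem abs_fst_sub_le_eucDist (p q : ℝ × ℝ) : |p.1 - q.1| ≤ eucDist p q :=
  Real.abs_le_sqrt (by nlinarith [sq_nonneg (p.2 - q.2)])

theorem stmt15 (a : ℝ) (ha : a < -1) :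
    ∃ η > (0 : ℝ), ∀ p q : ℤ → ℝ × ℝ,
      (∀ n : ℤ, (p n).1 ≠ 1 ∧ p (n + 1) = birat a (p n)) →
      (∀ n : ℤ, (q n).1 ≠ 1 ∧ q (n + 1) = birat a (q n)) →
      (∀ n : ℤ, p n ∈ Rzero ∪ Rone) →
      (∀ n : ℤ, q n ∈ Rzero ∪ Rone) →
      p 0 ≠ q 0 →
      ∃ n : ℤ, η < eucDist (p n) (q n) := by
  refine ⟨1 / 2, by norm_num, fun p q hp hq hpR hqR hne => ?_⟩
  by_contra! hclose
  obtain ⟨py, hpo⟩ := isOrb_of_birat ha hp hpR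
  obtain ⟨qy, hqo⟩ := isOrb_of_birat ha hq hqR
  obtain ⟨h1, h2⟩ := hpo.eq_of_close (by linarith) hqo
    (fun n => (abs_fst_sub_le_eucDist (p n) (q n)).trans (hclose n)) 0
  refine hne (Prod.ext h2 ?_)
  rw [py, qy, h1]
end
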